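/- arXiv:0806.4420 — 2 statements merged into one kernel-verified Lean document; each statement's English description precedes it below -/
import Mathlib

section
/- Let G = ⟨s₁,…,s_r⟩ be the free group of rank r, let G ↷ᵀ (X,B,μ) be a G-system, and let α and β be countable measurable partitions of X with H(α) + H(β) < ∞. Then f(T, α ∨ β) = f(T, α) + f(T, β | α^G). -/
open MeasureTheory Filter
open scoped ENNReal symmDiff

namespace Bowen

noncomputable section

/-- The free group of rank `r`. -/
abbrev FG (r : ℕ) := FreeGroup (Fin r)

/-- The generating set element corresponding to `(i, b)`: `sᵢ` if `b = true`,
`sᵢ⁻¹` if `b = false`. -/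
def gen {r : ℕ} (s : Fin r × Bool) : FG r :=
  cond s.2 (FreeGroup.of s.1) (FreeGroup.of s.1)⁻¹

/-- The symmetric generating set `S = {s₁^{±1},…,s_r^{±1}}`. -/
def Sset (r : ℕ) : Set (FG r) := Set.range (gen (r := r))

/-- The ball of radius `n` about the identity in the word metric of `(G,S)`. -/
def ball (r n : ℕ) : Set (FG r) := {g | FreeGroup.norm g ≤ n}

section Partitions

variable {X : Type*} [mX : MeasurableSpace X] {K L : Type*}

/-- Shannon entropy of the countable labeled partition `p` with respect to `μ`
(in `ℝ≥0∞`, so that `H(p) < ∞` is meaningful). -/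
def Hpart (μ : Measure X) (p : X → K) : ℝ≥0∞ :=
  ∑' k : K, ENNReal.ofReal (Real.negMulLog ((μ (p ⁻¹' {k})).toReal))

/-- The atom of the partition `p` containing `x`. -/
def atomOf (p : X → K) (x : X) : Set X := p ⁻¹' {p x}

/-- Conditional Shannon entropy of `p` given the sub-σ-algebra `m`:
`H(p|m) = ∫ -log( μ(A_x | m)(x) ) dμ(x)`. -/
def HpartC (μ : Measure X) (p : X → K) (m : MeasurableSpace X) : ℝ≥0∞ :=
  ∫⁻ x, ENNReal.ofReal
    (- Real.log ((μ[(atomOf p x).indicator (fun _ => (1:ℝ)) | m]) x)) ∂μ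

/-- Join of two labeled partitions. -/
def pjoin (p : X → K) (q : X → L) : X → K × L := fun x => (p x, q x)

/-- Pullback partition `T_g^{-1} p`. -/
def pull {r : ℕ} (T : FG r → X → X) (g : FG r) (p : X → K) : X → K :=
  fun x => p (T g x)

/-- The join `⋁_{q ∈ Q} T_q^{-1} p` over a set `Q ⊆ G`. -/
def powS {r : ℕ} (T : FG r → X → X) (p : X → K) (Q : Set (FG r)) : X → (Q → K) :=
  fun x q => p (T (q : FG r) x)

/-- The join `p^n = ⋁_{g ∈ B(e,n)} T_g^{-1} p`. -/
def pow {r : ℕ} (T : FG r → X → X) (p : X → K) (n : ℕ) : X → (ball r n → K) :=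
  powS T p (ball r n)

/-- The σ-algebra generated by the partition `p`. -/
def sAlg (p : X → K) : MeasurableSpace X := MeasurableSpace.comap p ⊤

/-- The smallest `G`-invariant σ-algebra containing the partition `p`. -/
def sAlgG {r : ℕ} (T : FG r → X → X) (p : X → K) : MeasurableSpace X :=
  ⨆ g : FG r, sAlg (pull T g p)

/-- The σ-algebra `⋁_{f ∈ Q} T_f^{-1} p` for a (possibly infinite) `Q ⊆ G`. -/
def sAlgSet {r : ℕ} (T : FG r → X → X) (p : X → K) (Q : Set (FG r)) :
    MeasurableSpace X :=
  ⨆ f ∈ Q, sAlg (pull T f p)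

/-- `F(T,α) = (1−2r)H(α) + ∑ᵢ H(α ∨ T_{sᵢ}^{-1}α)`. -/
def FF {r : ℕ} (T : FG r → X → X) (μ : Measure X) (p : X → K) : ℝ :=
  (1 - 2 * (r : ℝ)) * (Hpart μ p).toReal
    + ∑ i : Fin r, (Hpart μ (pjoin p (pull T (FreeGroup.of i) p))).toReal

/-- `f(T,α) = inf_{n>0} F(T,α^n)`, as an extended real. -/
def littleF {r : ℕ} (T : FG r → X → X) (μ : Measure X) (p : X → K) : EReal :=
  ⨅ n : ℕ, ((FF T μ (pow T p (n + 1)) : ℝ) : EReal)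

/-- Conditional version `F(T,α|𝓕) = (1−2r)H(α|𝓕) + ∑ᵢ H(α ∨ T_{sᵢ}^{-1}α|𝓕)`. -/
def FFc {r : ℕ} (T : FG r → X → X) (μ : Measure X) (m : MeasurableSpace X)
    (p : X → K) : ℝ :=
  (1 - 2 * (r : ℝ)) * (HpartC (mX := mX) μ p m).toReal
    + ∑ i : Fin r, (HpartC (mX := mX) μ (pjoin p (pull T (FreeGroup.of i) p)) m).toReal

/-- Conditional `f(T,α|𝓕) = inf_{n>0} F(T,α^n|𝓕)`. -/
def littleFc {r : ℕ} (T : FG r → X → X) (μ : Measure X) (m : MeasurableSpace X)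
    (p : X → K) : EReal :=
  ⨅ n : ℕ, ((FFc (mX := mX) T μ m (pow T p (n + 1)) : ℝ) : EReal)

/-- The mean entropy `h(T_s, α) = lim_n H(⋁_{i=0}^n T_s^{-i}α)/(n+1)`; since the
sequence is subadditive the limit equals the infimum, which we take as the
definition. -/
def hrate {r : ℕ} (T : FG r → X → X) (μ : Measure X) (s : FG r) (p : X → K) : ℝ :=
  ⨅ n : ℕ, (Hpart μ (fun x (i : Fin (n + 1)) => p (T (s ^ (i : ℕ)) x))).toReal / (n + 1)

/-- Conditional mean entropy `h(T_s, α|𝓕) = lim_n H(⋁_{i=0}^n T_s^{-i}α | 𝓕)/(n+1)`;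
for an invariant `𝓕` the sequence is subadditive so the limit equals the infimum. -/
def hrateC {r : ℕ} (T : FG r → X → X) (μ : Measure X) (m : MeasurableSpace X)
    (s : FG r) (p : X → K) : ℝ :=
  ⨅ n : ℕ, (HpartC (mX := mX) μ (fun x (i : Fin (n + 1)) => p (T (s ^ (i : ℕ)) x)) m).toReal / (n + 1)

/-- `F_*(T,α) = (1−r)H(α) + ∑ᵢ h(T_{sᵢ},α)`. -/
def Fstar {r : ℕ} (T : FG r → X → X) (μ : Measure X) (p : X → K) : ℝ :=
  (1 - (r : ℝ)) * (Hpart μ p).toReal + ∑ i : Fin r, hrate T μ (FreeGroup.of i) p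

/-- `f_*(T,α) = inf_{n>0} F_*(T,α^n)`. -/
def fstar {r : ℕ} (T : FG r → X → X) (μ : Measure X) (p : X → K) : EReal :=
  ⨅ n : ℕ, ((Fstar T μ (pow T p (n + 1)) : ℝ) : EReal)

/-- `F_*(T,α|𝓕) = (1−r)H(α|𝓕) + ∑ᵢ h(T_{sᵢ},α|𝓕)`. -/
def FstarC {r : ℕ} (T : FG r → X → X) (μ : Measure X) (m : MeasurableSpace X)
    (p : X → K) : ℝ :=
  (1 - (r : ℝ)) * (HpartC (mX := mX) μ p m).toReal + ∑ i : Fin r, hrateC (mX := mX) T μ m (FreeGroup.of i) p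

/-- `f_*(T,α|𝓕) = inf_{n>0} F_*(T,α^n|𝓕)`. -/
def fstarC {r : ℕ} (T : FG r → X → X) (μ : Measure X) (m : MeasurableSpace X)
    (p : X → K) : EReal :=
  ⨅ n : ℕ, ((FstarC (mX := mX) T μ m (pow T p (n + 1)) : ℝ) : EReal)

/-- `p` refines `q`: each atom of `p` is contained, up to a `μ`-null set,
in an atom of `q`. -/
def Refines (μ : Measure X) (p : X → K) (q : X → L) : Prop :=
  ∀ k : K, ∃ l : L, μ (p ⁻¹' {k} \ q ⁻¹' {l}) = 0

/-- Two labeled partitions are equal as partitions (up to null sets). -/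
def PartEquiv (μ : Measure X) (p : X → K) (q : X → L) : Prop :=
  Refines μ p q ∧ Refines μ q p

/-- `σ` is a simple splitting of `p`: `σ = p ∨ T_s^{-1}β` for some `s ∈ S` and
some coarsening `β` of `p`. -/
def SimpleSplit {r : ℕ} (μ : Measure X) (T : FG r → X → X) (p σ : X → ℕ) : Prop :=
  ∃ s ∈ Sset r, ∃ β : X → ℕ, Measurable β ∧ Refines μ p β ∧
    PartEquiv μ σ (pjoin p (pull T s β))

/-- `τ` is a splitting of `p`: obtained from `p` by a finite sequence of simple
splittings (as a partition, i.e. up to relabeling and null sets). -/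
def IsSplitting {r : ℕ} (μ : Measure X) (T : FG r → X → X) (p : X → ℕ)
    (τ : X → K) : Prop :=
  ∃ σ : X → ℕ, Relation.ReflTransGen (SimpleSplit μ T) p σ ∧ PartEquiv μ σ τ

/-- A partition is generating if the smallest `G`-invariant σ-algebra containing it
is the full σ-algebra up to `μ`-null sets. -/
def Generating {r : ℕ} (T : FG r → X → X) (μ : Measure X) (p : X → K) : Prop :=
  ∀ A : Set X, MeasurableSet A →
    ∃ A' : Set X, MeasurableSet[sAlgG T p] A' ∧ μ (A ∆ A') = 0

/-- The Rohlin distance `d(α,β) = H(α|β) + H(β|α)`. -/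
def rohlinDist (μ : Measure X) (p : X → K) (q : X → L) : ℝ :=
  (HpartC μ p (sAlg q)).toReal + (HpartC μ q (sAlg p)).toReal

end Partitions

/-- Adjacency in the left Cayley graph `Γ_L`: an edge joins `a` and `sa`, `s ∈ S`. -/
def adjL {r : ℕ} (a b : FG r) : Prop := ∃ s ∈ Sset r, b = s * a

/-- `Past(g₁;g₂)`: the set of `f ∈ G` such that every path in the left Cayley
graph from `f` to `g₁` passes through `g₂`. -/
def Past {r : ℕ} (g₁ g₂ : FG r) : Set (FG r) :=
  {f | ∀ l : List (FG r), l ≠ [] → l.head? = some f → l.getLast? = some g₁ →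
        l.Chain' adjL → g₂ ∈ l}

/-- A subset `F ⊆ G` is right-connected: the subgraph of the right Cayley graph
induced on `F` is connected. -/
def RightConnected {r : ℕ} (F : Set (FG r)) : Prop :=
  ∀ g ∈ F, ∀ h ∈ F,
    Relation.ReflTransGen (fun a b => a ∈ F ∧ b ∈ F ∧ ∃ s ∈ Sset r, b = a * s) g h

/-- A subset `F ⊆ G` is left-connected: the subgraph of the left Cayley graph
induced on `F` is connected. -/
def LeftConnected {r : ℕ} (F : Set (FG r)) : Prop :=
  ∀ g ∈ F, ∀ h ∈ F,
    Relation.ReflTransGen (fun a b => a ∈ F ∧ b ∈ F ∧ ∃ s ∈ Sset r, b = s * a) g h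

section Markov

variable {X : Type*} [MeasurableSpace X] {K : Type*}

/-- A `G`-process `(T,X,μ,α)` is Markov: for every `s ∈ S`, `g ∈ G` and every atom
`A` of `α`, `μ(T_{sg}^{-1}A | ⋁_{f∈Past(sg;g)} T_f^{-1}α) = μ(T_{sg}^{-1}A | T_g^{-1}α)`
almost everywhere. -/
def IsMarkov {r : ℕ} (μ : Measure X) (T : FG r → X → X) (p : X → K) : Prop :=
  ∀ s ∈ Sset r, ∀ g : FG r, ∀ k : K,
    (μ[((pull T (s * g) p) ⁻¹' {k}).indicator (fun _ => (1:ℝ)) |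
        sAlgSet T p (Past (s * g) g)])
      =ᵐ[μ]
    (μ[((pull T (s * g) p) ⁻¹' {k}).indicator (fun _ => (1:ℝ)) |
        sAlg (pull T g p)])

end Markov


section ExtraDefs

/-- The distance `d₁` between two ordered processes:
`∑_{s∈S} ∑_{i,j} |μ(A_i ∩ T_s^{-1}A_j) − ν(B_i ∩ U_s^{-1}B_j)|`. -/
def d1 {X Y : Type*} [MeasurableSpace X] [MeasurableSpace Y] {r : ℕ}
    (T : FG r → X → X) (μ : Measure X) (α : X → ℕ)
    (U : FG r → Y → Y) (ν : Measure Y) (β : Y → ℕ) : ℝ :=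
  ∑ i : Fin r, ∑ b : Bool,
    ∑' ij : ℕ × ℕ,
      |(μ (α ⁻¹' {ij.1} ∩ pull T (gen (i, b)) α ⁻¹' {ij.2})).toReal -
        (ν (β ⁻¹' {ij.1} ∩ pull U (gen (i, b)) β ⁻¹' {ij.2})).toReal|

/-- Isomorphism of ordered processes: a measure conjugacy between conull sets
intertwining the actions and carrying the `i`-th atom to the `i`-th atom. -/
def OrderedIso {X Y : Type*} [MeasurableSpace X] [MeasurableSpace Y] {r : ℕ}
    (T : FG r → X → X) (μ : Measure X) (α : X → ℕ)
    (U : FG r → Y → Y) (ν : Measure Y) (β : Y → ℕ) : Prop :=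
  ∃ (X' : Set X) (Y' : Set Y) (φ : X → Y) (ψ : Y → X),
    MeasurableSet X' ∧ MeasurableSet Y' ∧ μ X'ᶜ = 0 ∧ ν Y'ᶜ = 0 ∧
    Measurable φ ∧ Measurable ψ ∧ Set.MapsTo φ X' Y' ∧ Set.MapsTo ψ Y' X' ∧
    (∀ x ∈ X', ψ (φ x) = x) ∧ (∀ y ∈ Y', φ (ψ y) = y) ∧
    Measure.map φ μ = ν ∧
    (∀ (g : FG r), ∀ x ∈ X', φ (T g x) = U g (φ x)) ∧
    (∀ x ∈ X', β (φ x) = α x)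

/-- A transition system for `(G,S)`: a family of `K × K` matrices indexed by the
generating set together with a row vector, written as functions. -/
structure TransSys (r : ℕ) (K : Type*) where
  P : Fin r × Bool → K → K → ℝ
  pi : K → ℝ

/-- The transition system is an invariant transition system: the `P^s` are
stochastic matrices, `π` is a probability vector which is a steady state vector
for every `P^s`, and `π_i P^{s^{-1}}_{ij} = π_j P^s_{ji}`. -/
def TransSys.IsInvariant {r : ℕ} {K : Type*} (ts : TransSys r K) : Prop :=
  (∀ s i j, 0 ≤ ts.P s i j) ∧ (∀ s i, HasSum (ts.P s i) 1) ∧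
    (∀ i, 0 ≤ ts.pi i) ∧ HasSum ts.pi 1 ∧
    (∀ s j, HasSum (fun i => ts.pi i * ts.P s i j) (ts.pi j)) ∧
    (∀ s i j, ts.pi i * ts.P (s.1, !s.2) i j = ts.pi j * ts.P s j i)

/-- The canonical (shift) action of `G` on `K^G`: `(T_g x)(f) = x(fg)`. -/
def shiftT {r : ℕ} {K : Type*} : FG r → (FG r → K) → (FG r → K) :=
  fun g x f => x (f * g)

/-- `μ` is (a measure) induced by the transition system `ts`: the time-`e`
distribution is `π` and the transition probabilities into the complement of the
past are given by the matrices `P^s`.  (Note `T_g^{-1}A_k = {x : x(g) = k}`;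
the conditional equalities `μ(A|B) = c` are recorded in the equivalent product
form `μ(A ∩ B) = c·μ(B)`.) -/
def IsInducedBy {r : ℕ} {K : Type*} [MeasurableSpace K]
    (μ : Measure (FG r → K)) (ts : TransSys r K) : Prop :=
  (∀ k : K, μ {x | x 1 = k} = ENNReal.ofReal (ts.pi k)) ∧
  ∀ (s : Fin r × Bool) (g : FG r),
    FreeGroup.norm (gen s * g) = FreeGroup.norm g + 1 →
    ∀ (n : ℕ) (fs : Fin n → FG r) (ks : Fin n → K) (k₀ k : K),
      (∀ i, fs i ∈ Past (gen s * g) g ∧ fs i ≠ g) →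
      (μ ({x | x (gen s * g) = k} ∩ ({x | x g = k₀} ∩ ⋂ i, {x | x (fs i) = ks i}))
          = ENNReal.ofReal (ts.P s k₀ k) * μ ({x | x g = k₀} ∩ ⋂ i, {x | x (fs i) = ks i})) ∧
      μ ({x | x (gen s * g) = k} ∩ {x | x g = k₀})
          = ENNReal.ofReal (ts.P s k₀ k) * μ {x | x g = k₀}

end ExtraDefs

section Aux

variable {X : Type*} {m m' : MeasurableSpace X} [mX : MeasurableSpace X] {K L : Type*}

/-- measurable partition -/
def MP (p : X → K) : Prop := ∀ k, MeasurableSet (p ⁻¹' {k})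

lemma sAlg_le [Countable K] {p : X → K} (hp : MP p) : sAlg p ≤ mX := by
  rintro s ⟨t, -, rfl⟩
  have : p ⁻¹' t = ⋃ k ∈ t, p ⁻¹' {k} := by ext; simp
  rw [this]
  exact MeasurableSet.biUnion (Set.to_countable t) (fun k _ => hp k)

lemma MP_pjoin {p : X → K} {q : X → L} (hp : MP p) (hq : MP q) : MP (pjoin p q) := by
  rintro ⟨k, l⟩
  have : pjoin p q ⁻¹' {(k, l)} = p ⁻¹' {k} ∩ q ⁻¹' {l} := by ext; simp [pjoin]
  rw [this]
  exact (hp k).inter (hq l)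

/-- conditional probability of a set -/
abbrev cP {X : Type*} {mX : MeasurableSpace X} (μ : Measure X) (A : Set X) (m : MeasurableSpace X) : X → ℝ :=
  μ[A.indicator (fun _ => (1:ℝ)) | m]

variable {μ : Measure X} [IsProbabilityMeasure μ]

lemma integrable_ind {A : Set X} (hA : MeasurableSet A) :
    Integrable (A.indicator (fun _ => (1:ℝ))) μ :=
  (integrable_const 1).indicator hA

lemma cP_nonneg (A : Set X) : 0 ≤ᵐ[μ] cP μ A m := by
  apply condExp_nonneg
  exact Eventually.of_forall fun x => Set.indicator_nonneg (by simp) x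

lemma cP_le_one {A : Set X} (hA : MeasurableSet A) (hm : m ≤ mX) :
    cP μ A m ≤ᵐ[μ] fun _ => 1 := by
  have := condExp_mono (μ := μ) (m := m) (integrable_ind hA) (integrable_const (1:ℝ))
    (Eventually.of_forall fun x => Set.indicator_le_self' (by simp) x)
  rwa [condExp_const hm] at this

lemma lintegral_pullout {A : Set X} (hA : MeasurableSet A) (hm : m ≤ mX)
    {g : X → ℝ≥0∞} (hg : Measurable[m] g) :
    ∫⁻ x in A, g x ∂μ = ∫⁻ x, ENNReal.ofReal (cP μ A m x) * g x ∂μ := by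
  have hE : Measurable[m] (fun x => ENNReal.ofReal (cP μ A m x)) :=
    (stronglyMeasurable_condExp.measurable).ennreal_ofReal
  have key : (μ.restrict A).trim hm
      = @Measure.withDensity X m (μ.trim hm) (fun x => ENNReal.ofReal (cP μ A m x)) := by
    refine @Measure.ext X m _ _ fun s hs => ?_
    rw [trim_measurableSet_eq hm hs, Measure.restrict_apply (hm s hs),
      @withDensity_apply X m _ _ s hs, restrict_trim hm μ hs, lintegral_trim hm hE,
      ← ofReal_integral_eq_lintegral_ofReal integrable_condExp.integrableOn
        (ae_restrict_of_ae (cP_nonneg A)),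
      setIntegral_condExp hm (integrable_ind hA) hs, setIntegral_indicator hA]
    simp [Set.inter_comm]
  rw [← lintegral_trim hm hg, key,
    @lintegral_withDensity_eq_lintegral_mul X m _ _ hE _ hg, lintegral_trim hm (hE.mul hg)]
  rfl

/-- the `k`-th term -/
def hk {X : Type*} {mX : MeasurableSpace X} (μ : Measure X) (A : Set X) (m : MeasurableSpace X) : ℝ :=
  ∫ x, Real.negMulLog (cP μ A m x) ∂μ

lemma nml_bound {A : Set X} (hA : MeasurableSet A) (hm : m ≤ mX) :
    ∀ᵐ x ∂μ, 0 ≤ Real.negMulLog (cP μ A m x) ∧ Real.negMulLog (cP μ A m x) ≤ 1 := by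
  filter_upwards [cP_nonneg (μ := μ) A, cP_le_one (μ := μ) hA hm] with x h0 h1
  refine ⟨Real.negMulLog_nonneg h0 h1, ?_⟩
  have := Real.negMulLog_le_one_sub_self (x := cP μ A m x) h0
  have h0' : 0 ≤ cP μ A m x := h0
  linarith

lemma nml_meas {A : Set X} (hm : m ≤ mX) :
    Measurable (fun x => Real.negMulLog (cP μ A m x)) :=
  Real.continuous_negMulLog.measurable.comp
    ((stronglyMeasurable_condExp.measurable).mono hm le_rfl)

lemma nml_int {A : Set X} (hA : MeasurableSet A) (hm : m ≤ mX) :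
    Integrable (fun x => Real.negMulLog (cP μ A m x)) μ := by
  refine Integrable.of_bound (nml_meas hm).aestronglyMeasurable 1 ?_
  filter_upwards [nml_bound hA hm] with x hx
  rw [Real.norm_eq_abs, abs_of_nonneg hx.1]; exact hx.2

lemma HpartC_eq [Countable K] {p : X → K} (hp : MP p) (hm : m ≤ mX) :
    HpartC μ p m = ∑' k, ENNReal.ofReal (hk μ (p ⁻¹' {k}) m) := by
  unfold HpartC
  have hU : (⋃ k, p ⁻¹' {k}) = Set.univ := by ext; simp
  rw [← setLIntegral_univ, ← hU, lintegral_iUnion hp]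
  · refine tsum_congr fun k => ?_
    have h1 : ∫⁻ x in p ⁻¹' {k}, ENNReal.ofReal
        (- Real.log ((μ[(atomOf p x).indicator (fun _ => (1:ℝ)) | m]) x)) ∂μ
        = ∫⁻ x in p ⁻¹' {k}, ENNReal.ofReal (- Real.log (cP μ (p ⁻¹' {k}) m x)) ∂μ := by
      refine setLIntegral_congr_fun (hp k) fun x hx => ?_
      have : p x = k := hx
      simp only [atomOf, this]
    rw [h1, lintegral_pullout (hp k) hm, hk, ofReal_integral_eq_lintegral_ofReal
      (nml_int (hp k) hm) ((nml_bound (hp k) hm).mono fun x hx => hx.1)]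
    · refine lintegral_congr_ae ?_
      filter_upwards [cP_nonneg (μ := μ) (p ⁻¹' {k})] with x hx
      rw [← ENNReal.ofReal_mul hx]
      simp [Real.negMulLog]
    · exact ((Real.measurable_log.comp stronglyMeasurable_condExp.measurable).neg).ennreal_ofReal
  · intro i j hij
    exact Disjoint.preimage _ (by simpa using hij)

lemma cP_bot {A : Set X} (hA : MeasurableSet A) : cP μ A ⊥ = fun _ => (μ A).toReal := by
  unfold cP
  rw [condExp_bot]
  funext
  rw [integral_indicator hA]; simp [Measure.real]

lemma hk_bot {A : Set X} (hA : MeasurableSet A) : hk μ A ⊥ = Real.negMulLog (μ A).toReal := by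
  rw [hk, cP_bot hA]; simp

lemma Hpart_eq [Countable K] {p : X → K} (hp : MP p) : Hpart μ p = HpartC μ p ⊥ := by
  rw [HpartC_eq hp bot_le, Hpart]
  simp_rw [hk_bot (hp _)]

lemma Hpart_eq' [Countable K] {p : X → K} (hp : MP p) : Hpart μ p =
    ∫⁻ x, ENNReal.ofReal (- Real.log (μ (atomOf p x)).toReal) ∂μ := by
  rw [Hpart_eq hp, HpartC]
  refine lintegral_congr fun x => ?_
  have := cP_bot (μ := μ) (hp (p x))
  unfold cP at this
  unfold atomOf
  rw [this]

lemma hk_anti {A : Set X} (hA : MeasurableSet A) (hmm : m ≤ m')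
    (hm' : m' ≤ mX) : hk μ A m' ≤ hk μ A m := by
  have hm := hmm.trans hm'
  have h := ConcaveOn.condExp_map_le (μ := μ) hm (f := cP μ A m') Real.concaveOn_negMulLog
    (Real.continuous_negMulLog.upperSemicontinuous.upperSemicontinuousOn _)
    (cP_nonneg A) isClosed_Ici integrable_condExp (nml_int hA hm')
  have h2 : μ[cP μ A m' | m] =ᵐ[μ] cP μ A m := condExp_condExp_of_le hmm hm'
  unfold hk
  have h3 : ∫ x, Real.negMulLog (cP μ A m' x) ∂μ
      = ∫ x, (μ[Real.negMulLog ∘ cP μ A m' | m]) x ∂μ := (integral_condExp hm).symm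
  rw [h3]
  refine integral_mono_ae integrable_condExp (nml_int hA hm) ?_
  filter_upwards [h, h2] with x hx hx2
  rw [← hx2]; exact hx

lemma hk_nonneg {A : Set X} (hA : MeasurableSet A) (hm : m ≤ mX) :
    0 ≤ hk μ A m := integral_nonneg_of_ae ((nml_bound hA hm).mono fun x hx => hx.1)

lemma HpartC_anti [Countable K] {p : X → K} (hp : MP p) (hmm : m ≤ m')
    (hm' : m' ≤ mX) : HpartC μ p m' ≤ HpartC μ p m := by
  rw [HpartC_eq hp hm', HpartC_eq hp (hmm.trans hm')]
  exact ENNReal.tsum_le_tsum fun k => ENNReal.ofReal_le_ofReal (hk_anti (hp k) hmm hm')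

lemma HpartC_le [Countable K] {p : X → K} (hp : MP p)
    (hm : m ≤ mX) : HpartC μ p m ≤ Hpart μ p := by
  rw [Hpart_eq hp]; exact HpartC_anti hp bot_le hm

lemma HpartC_toReal [Countable K] {p : X → K} (hp : MP p) (hm : m ≤ mX)
    : (HpartC μ p m).toReal = ∑' k, hk μ (p ⁻¹' {k}) m := by
  rw [HpartC_eq hp hm, ENNReal.tsum_toReal_eq (by simp)]
  exact tsum_congr fun k => ENNReal.toReal_ofReal (hk_nonneg (hp k) hm)

lemma HpartC_tendsto [Countable K] {p : X → K} (hp : MP p) (hfin : Hpart μ p < ⊤)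
    (ℱ : Filtration ℕ mX) :
    Tendsto (fun n => (HpartC μ p (ℱ n)).toReal) atTop
      (nhds (HpartC μ p (⨆ n, ℱ n)).toReal) := by
  have hle : ⨆ n, ℱ n ≤ mX := iSup_le fun n => ℱ.le n
  rw [HpartC_toReal hp hle]
  simp_rw [fun n => HpartC_toReal (μ := μ) hp (ℱ.le n)]
  have hs : Summable (fun k => hk μ (p ⁻¹' {k}) ⊥) := by
    rw [Hpart_eq hp, HpartC_eq hp bot_le] at hfin
    have := ENNReal.summable_toReal hfin.ne
    refine this.congr fun k => ?_
    exact ENNReal.toReal_ofReal (hk_nonneg (hp k) bot_le)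
  refine tendsto_tsum_of_dominated_convergence hs ?_ ?_
  · intro k
    unfold hk
    refine tendsto_integral_of_dominated_convergence (fun _ => 1)
      (fun n => (nml_meas (ℱ.le n)).aestronglyMeasurable) (integrable_const _) ?_ ?_
    · intro n
      filter_upwards [nml_bound (hp k) (ℱ.le n)] with x hx
      rw [Real.norm_eq_abs, abs_of_nonneg hx.1]; exact hx.2
    · filter_upwards [tendsto_ae_condExp (μ := μ) (ℱ := ℱ)
        ((p ⁻¹' {k}).indicator (fun _ => (1:ℝ)))] with x hx
      exact (Real.continuous_negMulLog.tendsto _).comp hx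
  · refine Eventually.of_forall fun n k => ?_
    rw [Real.norm_eq_abs, abs_of_nonneg (hk_nonneg (hp k) (ℱ.le n))]
    exact hk_anti (hp k) bot_le (ℱ.le n)

lemma ae_atom_pos [Countable K] {p : X → K} : ∀ᵐ x ∂μ, μ (atomOf p x) ≠ 0 := by
  have : ∀ᵐ x ∂μ, ∀ k, μ (p ⁻¹' {k}) = 0 → x ∉ p ⁻¹' {k} := by
    rw [ae_all_iff]
    intro k
    by_cases h : μ (p ⁻¹' {k}) = 0
    · filter_upwards [measure_eq_zero_iff_ae_notMem.1 h] with x hx _ using hx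
    · simp [h]
  filter_upwards [this] with x hx h
  exact hx (p x) h rfl

lemma cP_sAlg [Countable L] {q : X → L} (hq : MP q) {A : Set X} (hA : MeasurableSet A) :
    (fun x => (μ (A ∩ atomOf q x)).toReal / (μ (atomOf q x)).toReal) =ᵐ[μ] cP μ A (sAlg q) := by
  have hm := sAlg_le hq
  set G : L → ℝ := fun l => (μ (A ∩ q ⁻¹' {l})).toReal / (μ (q ⁻¹' {l})).toReal with hG
  have hmeas : Measurable[sAlg q] (fun x => G (q x)) := by
    have h1 : Measurable[⊤] G := fun _ _ => trivial
    exact h1.comp (@comap_measurable _ _ ⊤ q)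
  have hbd : ∀ x, ‖G (q x)‖ ≤ 1 := by
    intro x
    rw [Real.norm_eq_abs, abs_of_nonneg (by positivity)]
    apply div_le_one_of_le₀ _ (by positivity)
    exact ENNReal.toReal_mono (measure_ne_top _ _) (measure_mono Set.inter_subset_right)
  have hint : Integrable (fun x => G (q x)) μ :=
    Integrable.of_bound (hmeas.mono hm le_rfl).aestronglyMeasurable 1
      (Eventually.of_forall hbd)
  refine ae_eq_condExp_of_forall_setIntegral_eq hm (integrable_ind hA)
    (fun s _ _ => hint.integrableOn) ?_ hmeas.stronglyMeasurable.aestronglyMeasurable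
  rintro s ⟨t, -, rfl⟩ -
  have hu : q ⁻¹' t = ⋃ l : t, q ⁻¹' {(l : L)} := by ext; simp
  have hd : Pairwise (Function.onFun Disjoint fun l : t => q ⁻¹' {(l : L)}) := by
    intro i j hij
    exact Disjoint.preimage _ (by simpa [Subtype.ext_iff] using hij)
  change ∫ x in q ⁻¹' t, G (q x) ∂μ = _
  rw [hu, integral_iUnion (fun l => hq _) hd hint.integrableOn,
    integral_iUnion (fun l => hq _) hd (integrable_ind hA).integrableOn]
  refine tsum_congr fun l => ?_
  have e1 : ∫ x in q ⁻¹' {(l : L)}, G (q x) ∂μ = ∫ x in q ⁻¹' {(l : L)}, G l ∂μ := by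
    refine setIntegral_congr_fun (hq _) fun x hx => ?_
    have : q x = l := hx
    simp only [this]
  rw [e1, setIntegral_const, setIntegral_indicator hA, setIntegral_const]
  simp only [hG, Set.inter_comm A, Measure.real, smul_eq_mul, mul_one]
  by_cases h : (μ (q ⁻¹' {(l : L)})).toReal = 0
  · rw [h]
    have : (μ (q ⁻¹' {(l : L)} ∩ A)).toReal ≤ (μ (q ⁻¹' {(l : L)})).toReal :=
      ENNReal.toReal_mono (measure_ne_top _ _) (measure_mono Set.inter_subset_left)
    have h2 : 0 ≤ (μ (q ⁻¹' {(l : L)} ∩ A)).toReal := by positivity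
    linarith
  · field_simp

lemma chain [Countable K] [Countable L] {p : X → K} {q : X → L} (hp : MP p) (hq : MP q) :
    HpartC μ p (sAlg q) + Hpart μ q = Hpart μ (pjoin p q) := by
  rw [Hpart_eq' hq, Hpart_eq' (MP_pjoin hp hq), HpartC, ← lintegral_add_right']
  · refine lintegral_congr_ae ?_
    have h1 : ∀ᵐ x ∂μ, ∀ k, (μ (p ⁻¹' {k} ∩ atomOf q x)).toReal / (μ (atomOf q x)).toReal
        = cP μ (p ⁻¹' {k}) (sAlg q) x := by
      rw [ae_all_iff]; exact fun k => cP_sAlg hq (hp k)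
    filter_upwards [h1, ae_atom_pos (μ := μ) (p := q),
      ae_atom_pos (μ := μ) (p := pjoin p q)] with x h1 h2 h3
    have h4 : atomOf (pjoin p q) x = p ⁻¹' {p x} ∩ atomOf q x := by
      ext; simp [atomOf, pjoin]
    rw [h4] at h3 ⊢
    have h5 : (μ[(atomOf p x).indicator (fun _ => (1:ℝ)) | sAlg q]) x
      = (μ (p ⁻¹' {p x} ∩ atomOf q x)).toReal / (μ (atomOf q x)).toReal := (h1 (p x)).symm
    rw [h5]
    have p2 : 0 < (μ (atomOf q x)).toReal := ENNReal.toReal_pos h2 (measure_ne_top _ _)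
    have p3 : 0 < (μ (p ⁻¹' {p x} ∩ atomOf q x)).toReal :=
      ENNReal.toReal_pos h3 (measure_ne_top _ _)
    have le1 : (μ (p ⁻¹' {p x} ∩ atomOf q x)).toReal ≤ (μ (atomOf q x)).toReal :=
      ENNReal.toReal_mono (measure_ne_top _ _) (measure_mono Set.inter_subset_right)
    have le2 : (μ (atomOf q x)).toReal ≤ 1 :=
      ENNReal.toReal_mono ENNReal.one_ne_top prob_le_one
    rw [Real.log_div p3.ne' p2.ne', ← ENNReal.ofReal_add]
    · congr 1; ring
    · have := Real.log_le_log p3 le1; linarith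
    · have := Real.log_nonpos p2.le le2; linarith
  · refine Measurable.aemeasurable ?_
    have h1 : Measurable[⊤] (fun l => ENNReal.ofReal (- Real.log (μ (q ⁻¹' {l})).toReal)) :=
      fun _ _ => trivial
    exact (h1.comp (@comap_measurable _ _ ⊤ q)).mono (sAlg_le hq) le_rfl

end Aux

section Comb

variable {X : Type*} [mX : MeasurableSpace X] {K L : Type*} {μ : Measure X}
  [IsProbabilityMeasure μ]

lemma atomOf_congr {p : X → K} {q : X → L} (h : ∀ x y, p x = p y ↔ q x = q y) (x : X) :
    atomOf p x = atomOf q x := by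
  ext y; simp [atomOf, h]

lemma Hpart_congr [Countable K] [Countable L] {p : X → K} {q : X → L} (hp : MP p) (hq : MP q)
    (h : ∀ x y, p x = p y ↔ q x = q y) : Hpart μ p = Hpart μ q := by
  rw [Hpart_eq' hp, Hpart_eq' hq]
  simp_rw [atomOf_congr h]

lemma HpartC_congr {p : X → K} {q : X → L} (m : MeasurableSpace X)
    (h : ∀ x y, p x = p y ↔ q x = q y) : HpartC (mX := mX) μ p m = HpartC (mX := mX) μ q m := by
  unfold HpartC
  simp_rw [atomOf_congr h]

/-- Joint labelling indexed by a finite set of pairs (partition, group element). -/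
def Y {r : ℕ} (T : FG r → X → X) (γ : Bool → X → ℕ) (D : Finset (Bool × FG r)) :
    X → (D → ℕ) := fun x d => γ d.1.1 (T d.1.2 x)

/-- right shift of an index set -/
def sh {r : ℕ} (D : Finset (Bool × FG r)) (s : FG r) : Finset (Bool × FG r) :=
  D.image (fun d => (d.1, d.2 * s))

/-- entropy of an index set -/
def HD {r : ℕ} (T : FG r → X → X) (μ : Measure X) (γ : Bool → X → ℕ)
    (D : Finset (Bool × FG r)) : ℝ := (Hpart μ (Y T γ D)).toReal

/-- `F` of an index set -/
def FD {r : ℕ} (H : Finset (Bool × FG r) → ℝ) (D : Finset (Bool × FG r)) : ℝ :=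
  (1 - 2 * (r : ℝ)) * H D + ∑ i : Fin r, H (D ∪ sh D (FreeGroup.of i))

lemma Y_eq {r : ℕ} {T : FG r → X → X} {γ : Bool → X → ℕ} {D : Finset (Bool × FG r)} {x y : X} :
    Y T γ D x = Y T γ D y ↔ ∀ d ∈ D, γ d.1 (T d.2 x) = γ d.1 (T d.2 y) := by
  simp only [funext_iff, Y, Subtype.forall]

lemma sAlg_Y_mono {r : ℕ} {T : FG r → X → X} {γ : Bool → X → ℕ} {C D : Finset (Bool × FG r)}
    (h : C ⊆ D) : sAlg (Y T γ C) ≤ sAlg (Y T γ D) := by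
  rintro s ⟨t, -, rfl⟩
  exact ⟨(fun f (c : C) => f ⟨c.1, h c.2⟩) ⁻¹' t, trivial, rfl⟩

variable {r : ℕ} {T : FG r → X → X} {γ : Bool → X → ℕ}

lemma MP_Y (hT : ∀ g, MeasurePreserving (T g) μ μ) (hγ : ∀ b, Measurable (γ b))
    (D : Finset (Bool × FG r)) : MP (Y T γ D) := by
  have : Measurable (Y T γ D) :=
    measurable_pi_iff.2 fun d => (hγ _).comp (hT _).measurable
  exact fun k => this (measurableSet_singleton k)

lemma Hpart_comp {p : X → K} (hp : MP p) {S : X → X} (hS : MeasurePreserving S μ μ) :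
    Hpart μ (fun x => p (S x)) = Hpart μ p := by
  unfold Hpart
  refine tsum_congr fun k => ?_
  rw [← hS.measure_preimage (hp k).nullMeasurableSet]
  rfl

lemma Hpart_union (hT : ∀ g, MeasurePreserving (T g) μ μ) (hγ : ∀ b, Measurable (γ b))
    (A D : Finset (Bool × FG r)) :
    Hpart μ (Y T γ (A ∪ D)) = HpartC μ (Y T γ A) (sAlg (Y T γ D)) + Hpart μ (Y T γ D) := by
  rw [chain (MP_Y hT hγ A) (MP_Y hT hγ D)]
  refine Hpart_congr (MP_Y hT hγ _) (MP_pjoin (MP_Y hT hγ A) (MP_Y hT hγ D)) fun x y => ?_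
  simp only [pjoin, Prod.mk.injEq, Y_eq, Finset.mem_union, or_imp, forall_and]

lemma Hpart_fin (hT : ∀ g, MeasurePreserving (T g) μ μ) (hγ : ∀ b, Measurable (γ b))
    (hf : ∀ b, Hpart μ (γ b) < ⊤) (D : Finset (Bool × FG r)) : Hpart μ (Y T γ D) < ⊤ := by
  induction D using Finset.induction_on with
  | empty =>
    rw [Hpart_eq' (MP_Y hT hγ _)]
    have : ∀ x, atomOf (Y T γ (∅ : Finset (Bool × FG r))) x = Set.univ := by
      intro x; ext y
      simp only [atomOf, Set.mem_preimage, Set.mem_singleton_iff, Y_eq]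
      simp
    simp [this]
  | insert d D hd ih =>
    rw [Finset.insert_eq, Hpart_union hT hγ]
    refine ENNReal.add_lt_top.2 ⟨lt_of_le_of_lt (HpartC_le (MP_Y hT hγ _)
      (sAlg_le (MP_Y hT hγ _))) ?_, ih⟩
    have h1 : MP (fun x => γ d.1 (T d.2 x)) := fun k =>
      ((hγ _).comp (hT _).measurable) (measurableSet_singleton k)
    rw [Hpart_congr (q := fun x => γ d.1 (T d.2 x)) (MP_Y hT hγ _) h1,
      Hpart_comp (fun k => hγ _ (measurableSet_singleton k)) (hT d.2)]
    · exact hf _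
    · intro x y; rw [Y_eq]; simp

lemma HD_union (hT : ∀ g, MeasurePreserving (T g) μ μ) (hγ : ∀ b, Measurable (γ b))
    (hf : ∀ b, Hpart μ (γ b) < ⊤) (A D : Finset (Bool × FG r)) :
    HD T μ γ (A ∪ D) - HD T μ γ D = (HpartC μ (Y T γ A) (sAlg (Y T γ D))).toReal := by
  unfold HD
  rw [Hpart_union hT hγ, ENNReal.toReal_add _ (Hpart_fin hT hγ hf D).ne]
  · ring
  · exact (lt_of_le_of_lt (HpartC_le (MP_Y hT hγ _)
      (sAlg_le (MP_Y hT hγ _))) (Hpart_fin hT hγ hf A)).ne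

lemma HD_submod (hT : ∀ g, MeasurePreserving (T g) μ μ) (hγ : ∀ b, Measurable (γ b))
    (hf : ∀ b, Hpart μ (γ b) < ⊤) (d : Bool × FG r) {C D : Finset (Bool × FG r)} (h : C ⊆ D) :
    HD T μ γ (insert d D) - HD T μ γ D ≤ HD T μ γ (insert d C) - HD T μ γ C := by
  rw [Finset.insert_eq, Finset.insert_eq, HD_union hT hγ hf, HD_union hT hγ hf]
  refine ENNReal.toReal_mono ?_ (HpartC_anti (MP_Y hT hγ _) (sAlg_Y_mono h)
    (sAlg_le (MP_Y hT hγ _)))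
  exact (lt_of_le_of_lt (HpartC_le (MP_Y hT hγ _)
      (sAlg_le (MP_Y hT hγ _))) (Hpart_fin hT hγ hf _)).ne

lemma HD_sh (hTmul : ∀ g h : FG r, T (g * h) = T g ∘ T h)
    (hT : ∀ g, MeasurePreserving (T g) μ μ) (hγ : ∀ b, Measurable (γ b))
    (D : Finset (Bool × FG r)) (s : FG r) : HD T μ γ (sh D s) = HD T μ γ D := by
  unfold HD
  rw [← Hpart_comp (MP_Y hT hγ D) (hT s)]
  congr 1
  refine Hpart_congr (MP_Y hT hγ _)
    (fun k => (hT s).measurable (MP_Y hT hγ D k)) fun x y => ?_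
  rw [Y_eq, Y_eq]
  simp only [sh, Finset.forall_mem_image, hTmul, Function.comp]

lemma sh_insert (d : Bool × FG r) (D : Finset (Bool × FG r)) (s : FG r) :
    sh (insert d D) s = insert (d.1, d.2 * s) (sh D s) := by
  simp [sh, Finset.image_insert]

lemma sh_union (C D : Finset (Bool × FG r)) (s : FG r) :
    sh (C ∪ D) s = sh C s ∪ sh D s := by
  simp [sh, Finset.image_union]

/-- One simple splitting does not increase `F`. -/
lemma FD_insert {H : Finset (Bool × FG r) → ℝ}
    (hsub : ∀ (d : Bool × FG r) {C D : Finset (Bool × FG r)}, C ⊆ D →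
      H (insert d D) - H D ≤ H (insert d C) - H C)
    (hsh : ∀ D s, H (sh D s) = H D)
    (D : Finset (Bool × FG r)) (c : Bool) (h : FG r) (hD : (c, h) ∈ D) (t : Fin r × Bool) :
    FD H (insert (c, h * gen t) D) ≤ FD H D := by
  set d : Bool × FG r := (c, h * gen t) with hd
  set e := H (insert d D) - H D with he
  have step : ∀ i : Fin r, H (insert d D ∪ sh (insert d D) (FreeGroup.of i))
      - H (D ∪ sh D (FreeGroup.of i)) ≤ if i = t.1 then e else 2 * e := by
    intro i
    set E := D ∪ sh D (FreeGroup.of i) with hE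
    set d' : Bool × FG r := (c, h * gen t * FreeGroup.of i) with hd'
    have hU : insert d D ∪ sh (insert d D) (FreeGroup.of i) = insert d (insert d' E) := by
      rw [sh_insert, hE]
      ext z; simp [hd, hd']; tauto
    rw [hU]
    have hDE : D ⊆ E := Finset.subset_union_left
    have hDE' : sh D (FreeGroup.of i) ⊆ E := Finset.subset_union_right
    have h1 : H (insert d (insert d' E)) - H (insert d' E) ≤ e :=
      hsub d (hDE.trans (Finset.subset_insert _ _))
    have h2 : H (insert d' E) - H E ≤ e := by
      refine (hsub d' hDE').trans ?_
      have : insert d' (sh D (FreeGroup.of i)) = sh (insert d D) (FreeGroup.of i) := by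
        rw [sh_insert]
      rw [this, hsh, hsh]
    split_ifs with hi
    · obtain ⟨j, b⟩ := t
      simp only at hi
      subst hi
      cases b
      · have : d' ∈ E := by
          apply hDE
          simpa [hd', gen] using hD
        rw [Finset.insert_eq_self.2 this] at h1 ⊢
        linarith
      · have : d ∈ E := by
          apply hDE'
          simp only [sh, Finset.mem_image]
          exact ⟨(c, h), hD, rfl⟩
        rw [Finset.insert_eq_self.2 (Finset.mem_insert_of_mem this)]
        linarith
    · linarith
  have hsum := Finset.sum_le_sum (fun i (_ : i ∈ Finset.univ) => step i)
  rw [Finset.sum_sub_distrib] at hsum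
  have hval : ∑ i : Fin r, (if i = t.1 then e else 2 * e) = (2 * r - 1) * e := by
    have : ∀ i : Fin r, (if i = t.1 then e else 2 * e) = 2 * e - (if i = t.1 then e else 0) := by
      intro i; split_ifs <;> ring
    simp_rw [this]
    rw [Finset.sum_sub_distrib, Finset.sum_ite_eq']
    simp; ring
  rw [hval] at hsum
  unfold FD
  have : H (insert d D) = H D + e := by rw [he]; ring
  rw [this]
  linarith

lemma FD_anti {H : Finset (Bool × FG r) → ℝ}
    (hsub : ∀ (d : Bool × FG r) {C D : Finset (Bool × FG r)}, C ⊆ D →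
      H (insert d D) - H D ≤ H (insert d C) - H C)
    (hsh : ∀ D s, H (sh D s) = H D)
    (D W : Finset (Bool × FG r))
    (hW : ∀ d ∈ W, d ∈ D ∨ ∃ h t, (d.1, h) ∈ D ∧ d.2 = h * gen t) :
    FD H (W ∪ D) ≤ FD H D := by
  induction W using Finset.induction_on with
  | empty => simp
  | insert d W hd ih =>
    have ih' := ih (fun d' h' => hW d' (Finset.mem_insert_of_mem h'))
    rw [Finset.insert_union]
    rcases hW d (Finset.mem_insert_self _ _) with h | ⟨h, t, h1, h2⟩
    · rwa [Finset.insert_eq_self.2 (Finset.mem_union_right _ h)]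
    · have : d = (d.1, h * gen t) := by rw [← h2]
      rw [this]
      exact (FD_insert hsub hsh _ _ _ (Finset.mem_union_right _ h1) t).trans ih'

lemma ball_finite (r n : ℕ) : (ball r n).Finite := by
  refine Set.Finite.subset ((List.finite_length_le (Fin r × Bool) n).image FreeGroup.mk) ?_
  intro g hg
  exact ⟨g.toWord, hg, FreeGroup.mk_toWord⟩

lemma ball_succ {n : ℕ} {g : FG r} (hg : g ∈ ball r (n + 1)) :
    g ∈ ball r n ∨ ∃ h t, h ∈ ball r n ∧ g = h * gen t := by
  rcases List.eq_nil_or_concat g.toWord with h | ⟨L, t, h⟩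
  · left
    simp [ball, FreeGroup.norm, h]
  · right
    have hlen : L.length ≤ n := by
      have : g.toWord.length ≤ n + 1 := hg
      rw [h] at this
      simpa using this
    refine ⟨FreeGroup.mk L, t, FreeGroup.norm_mk_le.trans hlen, ?_⟩
    rw [← FreeGroup.mk_toWord (x := g), h, List.concat_eq_append, ← FreeGroup.mul_mk]
    congr 1
    obtain ⟨i, b⟩ := t
    cases b <;> simp [gen, FreeGroup.of, FreeGroup.inv_mk, FreeGroup.invRev]

/-- the index set of `γ b` over the ball of radius `n` -/
def Bn (r : ℕ) (b : Bool) (n : ℕ) : Finset (Bool × FG r) :=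
  {b} ×ˢ (ball_finite r n).toFinset

lemma mem_Bn {b : Bool} {n : ℕ} {d : Bool × FG r} : d ∈ Bn r b n ↔ d.1 = b ∧ d.2 ∈ ball r n := by
  simp only [Bn, Finset.mem_product, Finset.mem_singleton, Set.Finite.mem_toFinset]

lemma ball_mono {n k : ℕ} (h : n ≤ k) : ball r n ⊆ ball r k := fun _ hg => le_trans hg h

lemma Bn_mono {b : Bool} {n k : ℕ} (h : n ≤ k) : Bn r b n ⊆ Bn r b k := by
  intro d hd
  rw [mem_Bn] at hd ⊢
  exact ⟨hd.1, ball_mono h hd.2⟩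

lemma FD_Bn {H : Finset (Bool × FG r) → ℝ}
    (hsub : ∀ (d : Bool × FG r) {C D : Finset (Bool × FG r)}, C ⊆ D →
      H (insert d D) - H D ≤ H (insert d C) - H C)
    (hsh : ∀ D s, H (sh D s) = H D) (b : Bool) (n : ℕ) (E : Finset (Bool × FG r)) :
    FD H (E ∪ Bn r b (n + 1)) ≤ FD H (E ∪ Bn r b n) := by
  have := FD_anti hsub hsh (E ∪ Bn r b n) (Bn r b (n + 1)) ?_
  · have h : Bn r b (n + 1) ∪ (E ∪ Bn r b n) = E ∪ Bn r b (n + 1) := by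
      have h0 : Bn r b n ⊆ Bn r b (n + 1) := Bn_mono (Nat.le_succ n)
      ext z
      have := @h0 z
      simp only [Finset.mem_union]; tauto
    rwa [h] at this
  · intro d hd
    rw [mem_Bn] at hd
    rcases ball_succ hd.2 with h | ⟨h, t, h1, h2⟩
    · exact Or.inl (Finset.mem_union_right _ (mem_Bn.2 ⟨hd.1, h⟩))
    · exact Or.inr ⟨h, t, Finset.mem_union_right _ (mem_Bn.2 ⟨hd.1, h1⟩), h2⟩

lemma diff_tendsto (hT : ∀ g, MeasurePreserving (T g) μ μ) (hγ : ∀ b, Measurable (γ b))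
    (hf : ∀ b, Hpart μ (γ b) < ⊤) (E : Finset (Bool × FG r)) (S : ℕ → Finset (Bool × FG r))
    (hS : Monotone S) (h1 : ∀ m, ∀ d ∈ S m, d.1 = true) (h2 : ∀ g, ∃ m, (true, g) ∈ S m) :
    Tendsto (fun m => HD T μ γ (E ∪ S m) - HD T μ γ (S m)) atTop
      (nhds (HpartC μ (Y T γ E) (sAlgG T (γ true))).toReal) := by
  let ℱ : Filtration ℕ mX :=
    { seq := fun m => sAlg (Y T γ (S m))
      mono' := fun a b hab => sAlg_Y_mono (hS hab)
      le' := fun m => sAlg_le (MP_Y hT hγ _) }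
  have hsup : ⨆ m, ℱ m = sAlgG T (γ true) := by
    apply le_antisymm
    · refine iSup_le fun m => ?_
      have hm : Measurable[sAlgG T (γ true)] (Y T γ (S m)) := by
        refine @measurable_pi_iff _ _ _ (sAlgG T (γ true)) _ _ |>.2 fun d => ?_
        have h3 : d.1.1 = true := h1 m d.1 d.2
        have h4 : sAlg (pull T d.1.2 (γ true)) ≤ sAlgG T (γ true) :=
          le_iSup (fun g => sAlg (pull T g (γ true))) d.1.2
        intro s hs
        refine h4 _ ⟨s, trivial, ?_⟩
        rw [← h3]; rfl
      rintro s ⟨t, -, rfl⟩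
      exact hm (Set.to_countable t).measurableSet
    · refine iSup_le fun g => ?_
      obtain ⟨m, hm⟩ := h2 g
      refine le_trans ?_ (le_iSup (fun m => ℱ m) m)
      rintro s ⟨t, -, rfl⟩
      exact ⟨(fun f : S m → ℕ => f ⟨(true, g), hm⟩) ⁻¹' t, trivial, rfl⟩
  rw [← hsup]
  simp_rw [HD_union hT hγ hf]
  exact HpartC_tendsto (MP_Y hT hγ E) (Hpart_fin hT hγ hf E) ℱ

lemma FD_diff_tendsto (hT : ∀ g, MeasurePreserving (T g) μ μ) (hγ : ∀ b, Measurable (γ b))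
    (hf : ∀ b, Hpart μ (γ b) < ⊤) (E : Finset (Bool × FG r)) :
    Tendsto (fun m => FD (HD T μ γ) (E ∪ Bn r true m) - FD (HD T μ γ) (Bn r true m)) atTop
      (nhds ((1 - 2 * (r : ℝ)) * (HpartC μ (Y T γ E) (sAlgG T (γ true))).toReal
        + ∑ i : Fin r, (HpartC μ (Y T γ (E ∪ sh E (FreeGroup.of i)))
          (sAlgG T (γ true))).toReal)) := by
  have hcov : ∀ g : FG r, ∃ m, (true, g) ∈ Bn r true m := fun g =>
    ⟨FreeGroup.norm g, mem_Bn.2 ⟨rfl, (le_refl (FreeGroup.norm g) : _)⟩⟩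
  have h1 := diff_tendsto hT hγ hf E (fun m => Bn r true m) (fun a b h => Bn_mono h)
    (fun m d hd => (mem_Bn.1 hd).1) hcov
  have h2 : ∀ i : Fin r, _ := fun i => diff_tendsto hT hγ hf (E ∪ sh E (FreeGroup.of i))
    (fun m => Bn r true m ∪ sh (Bn r true m) (FreeGroup.of i))
    (fun a b h => Finset.union_subset_union (Bn_mono h) (Finset.image_subset_image (Bn_mono h)))
    (fun m d hd => by
      rcases Finset.mem_union.1 hd with hd | hd
      · exact (mem_Bn.1 hd).1
      · obtain ⟨z, hz, rfl⟩ := Finset.mem_image.1 hd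
        exact (mem_Bn.1 hz).1)
    (fun g => (hcov g).imp fun m hm => Finset.mem_union_left _ hm)
  have h3 := (h1.const_mul (1 - 2 * (r : ℝ))).add
    (tendsto_finsetSum Finset.univ (fun i _ => h2 i))
  refine h3.congr fun m => ?_
  have h4 : ∀ i : Fin r, E ∪ sh E (FreeGroup.of i) ∪
      (Bn r true m ∪ sh (Bn r true m) (FreeGroup.of i))
      = (E ∪ Bn r true m) ∪ sh (E ∪ Bn r true m) (FreeGroup.of i) := by
    intro i
    rw [sh_union]
    ext z; simp only [Finset.mem_union]; tauto
  simp only [FD, h4, Finset.sum_sub_distrib]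
  ring

lemma pull_eq (hTmul : ∀ g h : FG r, T (g * h) = T g ∘ T h) (E : Finset (Bool × FG r)) (s : FG r)
    (x y : X) : Y T γ (sh E s) x = Y T γ (sh E s) y ↔ Y T γ E (T s x) = Y T γ E (T s y) := by
  rw [Y_eq, Y_eq]
  simp only [sh, Finset.forall_mem_image, hTmul, Function.comp]

lemma pjoin_pull_eq (hTmul : ∀ g h : FG r, T (g * h) = T g ∘ T h) {p : X → K}
    {D : Finset (Bool × FG r)} (h : ∀ x y, p x = p y ↔ Y T γ D x = Y T γ D y) (s : FG r) (x y : X) :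
    pjoin p (pull T s p) x = pjoin p (pull T s p) y ↔
      Y T γ (D ∪ sh D s) x = Y T γ (D ∪ sh D s) y := by
  have h1 := pull_eq (γ := γ) hTmul D s x y
  simp only [pjoin, pull, Prod.mk.injEq, h, ← h1]
  simp only [Y_eq, Finset.mem_union, or_imp, forall_and]

lemma FF_eq (hTmul : ∀ g h : FG r, T (g * h) = T g ∘ T h)
    (hT : ∀ g, MeasurePreserving (T g) μ μ) (hγ : ∀ b, Measurable (γ b)) [Countable K]
    {p : X → K} (hp : MP p) {D : Finset (Bool × FG r)}
    (h : ∀ x y, p x = p y ↔ Y T γ D x = Y T γ D y) :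
    FF T μ p = FD (HD T μ γ) D := by
  unfold FF FD HD
  rw [Hpart_congr hp (MP_Y hT hγ D) h]
  congr 1
  refine Finset.sum_congr rfl fun i _ => ?_
  rw [Hpart_congr (MP_pjoin hp (q := pull T (FreeGroup.of i) p) (fun k => (hT _).measurable (hp k))) (MP_Y hT hγ _)
    (pjoin_pull_eq hTmul h (FreeGroup.of i))]

lemma FFc_eq (hTmul : ∀ g h : FG r, T (g * h) = T g ∘ T h) (m : MeasurableSpace X)
    {p : X → K} {D : Finset (Bool × FG r)}
    (h : ∀ x y, p x = p y ↔ Y T γ D x = Y T γ D y) :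
    FFc (mX := mX) T μ m p = (1 - 2 * (r : ℝ)) * (HpartC (mX := mX) μ (Y T γ D) m).toReal
        + ∑ i : Fin r, (HpartC (mX := mX) μ (Y T γ (D ∪ sh D (FreeGroup.of i))) m).toReal := by
  unfold FFc
  rw [HpartC_congr (mX := mX) (μ := μ) m h]
  congr 1
  refine Finset.sum_congr rfl fun i _ => ?_
  rw [HpartC_congr (mX := mX) (μ := μ) m (pjoin_pull_eq hTmul h (FreeGroup.of i))]

lemma pow_eq (b : Bool) (n : ℕ) (x y : X) : pow T (γ b) n x = pow T (γ b) n y ↔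
    Y T γ (Bn r b n) x = Y T γ (Bn r b n) y := by
  rw [Y_eq]
  simp only [pow, powS, funext_iff, Subtype.forall, mem_Bn, Prod.forall]
  constructor
  · rintro h c g ⟨rfl, hg⟩; exact h g hg
  · intro h g hg; exact h b g ⟨rfl, hg⟩

lemma pow_pjoin_eq (n : ℕ) (x y : X) :
    pow T (pjoin (γ true) (γ false)) n x = pow T (pjoin (γ true) (γ false)) n y ↔
    Y T γ (Bn r false n ∪ Bn r true n) x = Y T γ (Bn r false n ∪ Bn r true n) y := by
  have h1 := pow_eq (T := T) (γ := γ) true n x y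
  have h2 := pow_eq (T := T) (γ := γ) false n x y
  rw [Y_eq] at h1 h2 ⊢
  simp only [Finset.mem_union, or_imp, forall_and, ← h1, ← h2]
  simp only [pow, powS, funext_iff, pjoin, Prod.mk.injEq, forall_and]
  tauto

instance (r n : ℕ) : Finite (ball r n) := ball_finite r n

lemma MP_pow (hT : ∀ g, MeasurePreserving (T g) μ μ) {p : X → K} (hp : MP p) (n : ℕ) :
    MP (pow T p n) := by
  intro k
  have : pow T p n ⁻¹' {k} = ⋂ g : ball r n, T g.1 ⁻¹' (p ⁻¹' {k g}) := by
    ext x; simp [pow, powS, funext_iff]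
  rw [this]
  exact MeasurableSet.iInter fun g => (hT _).measurable (hp _)

end Comb

lemma ereal_final (a : ℕ → ℝ) (c : ℕ → ℕ → ℝ) (d : ℕ → ℝ) (ha : Antitone a)
    (hc1 : ∀ n, Antitone (fun m => c m n)) (hc2 : ∀ m, Antitone (c m))
    (hd : ∀ n, Tendsto (fun m => c m n - a m) atTop (nhds (d n))) :
    (⨅ n, (c n n : EReal)) = (⨅ n, (a n : EReal)) + ⨅ n, (d n : EReal) := by
  have hda : Antitone d := fun i j hij =>
    le_of_tendsto_of_tendsto' (hd j) (hd i) fun m => by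
      have := hc2 m hij
      linarith
  have ha' : Antitone (fun n => (a n : EReal)) := fun i j h => EReal.coe_le_coe_iff.2 (ha h)
  have hd' : Antitone (fun n => (d n : EReal)) := fun i j h => EReal.coe_le_coe_iff.2 (hda h)
  have hta := tendsto_atTop_iInf ha'
  have htd := tendsto_atTop_iInf hd'
  have h1 : ∀ n, ⨅ m, (c m n : EReal) = (⨅ m, (a m : EReal)) + d n := by
    intro n
    have hc' : Antitone (fun m => (c m n : EReal)) := fun i j h =>
      EReal.coe_le_coe_iff.2 (hc1 n h)
    refine tendsto_nhds_unique (tendsto_atTop_iInf hc') ?_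
    have h2 : Tendsto (fun m => ((c m n - a m : ℝ) : EReal)) atTop (nhds (d n : EReal)) :=
      (continuous_coe_real_ereal.tendsto _).comp (hd n)
    have h3 := (EReal.continuousAt_add (p := (⨅ m, (a m : EReal), (d n : EReal)))
      (by simp) (by simp)).tendsto.comp (hta.prodMk_nhds h2)
    refine h3.congr fun m => ?_
    simp only [Function.comp]
    rw [← EReal.coe_add]; congr 1; ring
  have h4 : ⨅ n, (c n n : EReal) = ⨅ n, ⨅ m, (c m n : EReal) := by
    apply le_antisymm
    · refine le_iInf fun n => le_iInf fun m => ?_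
      refine (iInf_le _ (max m n)).trans (EReal.coe_le_coe_iff.2 ?_)
      exact (hc1 _ (le_max_left m n)).trans (hc2 _ (le_max_right m n))
    · exact le_iInf fun n => (iInf_le _ n).trans (iInf_le _ n)
  rw [h4]
  simp_rw [h1]
  by_cases hb : (⨅ m, (a m : EReal)) = ⊥
  · simp [hb]
  · have ht : (⨅ m, (a m : EReal)) ≠ ⊤ :=
      (lt_of_le_of_lt (iInf_le (fun m => (a m : EReal)) 0) (EReal.coe_lt_top _)).ne
    have hanti : Antitone (fun n => (⨅ m, (a m : EReal)) + (d n : EReal)) := fun i j h =>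
      add_le_add le_rfl (hd' h)
    refine tendsto_nhds_unique (tendsto_atTop_iInf hanti) ?_
    exact (EReal.continuousAt_add (p := (⨅ m, (a m : EReal), ⨅ n, (d n : EReal)))
      (by simp [ht]) (by simp [hb])).tendsto.comp (tendsto_const_nhds.prodMk_nhds htd)

/-- the Abramov–Rohlin formula for free groups:
`f(T, α ∨ β) = f(T, α) + f(T, β | α^G)`. -/
theorem stmt_0 {r : ℕ} (hr : 1 ≤ r) {X : Type*} [MeasurableSpace X] [StandardBorelSpace X]
    (μ : Measure X) [IsProbabilityMeasure μ]
    (T : FG r → X → X) (hT1 : T 1 = id)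
    (hTmul : ∀ g h : FG r, T (g * h) = T g ∘ T h)
    (hTmp : ∀ g : FG r, MeasurePreserving (T g) μ μ)
    (α β : X → ℕ) (hαm : Measurable α) (hβm : Measurable β)
    (hHα : Hpart μ α < ⊤) (hHβ : Hpart μ β < ⊤) :
    littleF T μ (pjoin α β) = littleF T μ α + littleFc T μ (sAlgG T α) β := by
  set γ : Bool → X → ℕ := fun b => cond b α β with hγdef
  have hγ : ∀ b, Measurable (γ b) := by intro b; cases b <;> assumption
  have hf : ∀ b, Hpart μ (γ b) < ⊤ := by intro b; cases b <;> assumption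
  have hMP : ∀ b, MP (γ b) := fun b k => hγ b (measurableSet_singleton k)
  have hα : α = γ true := rfl
  have hβ : β = γ false := rfl
  have hsub := @HD_submod X _ μ _ r T γ hTmp hγ hf
  have hsh := @HD_sh X _ μ _ r T γ hTmul hTmp hγ
  unfold littleF littleFc
  rw [hα, hβ]
  simp_rw [fun n => FF_eq (γ := γ) hTmul hTmp hγ
      (MP_pow hTmp (MP_pjoin (hMP true) (hMP false)) n) (pow_pjoin_eq n),
    fun n => FF_eq (γ := γ) hTmul hTmp hγ (MP_pow hTmp (hMP true) n) (pow_eq true n),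
    fun n => FFc_eq (γ := γ) (μ := μ) hTmul (sAlgG T (γ true)) (pow_eq false n)]
  refine ereal_final (fun m => FD (HD T μ γ) (Bn r true (m + 1)))
    (fun m n => FD (HD T μ γ) (Bn r false (n + 1) ∪ Bn r true (m + 1))) _ ?_ ?_ ?_ ?_
  · refine antitone_nat_of_succ_le fun n => ?_
    simpa using FD_Bn hsub hsh true (n + 1) ∅
  · intro n
    exact antitone_nat_of_succ_le fun m => FD_Bn hsub hsh true (m + 1) _
  · intro m
    refine antitone_nat_of_succ_le fun n => ?_
    rw [Finset.union_comm, Finset.union_comm (Bn r false (n + 1))]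
    exact FD_Bn hsub hsh false (n + 1) _
  · intro n
    exact (FD_diff_tendsto hTmp hγ hf (Bn r false (n + 1))).comp (tendsto_add_atTop_nat 1)

end

end Bowen
end

section
/- Let G = ⟨s₁,…,s_r⟩ be the free group of rank r, G ↷ᵀ (X,B,μ) a G-system, F ⊂ B a T(G)-invariant sub-σ-algebra, α a partition with H(α) < ∞, and σ a splitting of α. Then F(T,σ|F) ≤ F(T,α|F) and F_*(T,σ|F) ≤ F_*(T,α|F). -/
open MeasureTheory Filter
open scoped ENNReal symmDiff

namespace Bowen

noncomputable section

section Helpers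

variable {X : Type*} [mX : MeasurableSpace X] {K L J : Type*}

/-- All atoms measurable. -/
def PM (p : X → K) : Prop := ∀ k, MeasurableSet (p ⁻¹' {k})

lemma PM.measurable [Countable K] {p : X → K} (hp : PM p) :
    @Measurable X K mX ⊤ p := by
  let _ : MeasurableSpace K := ⊤
  exact measurable_to_countable' hp

lemma PM.of_measurable [MeasurableSpace K] [MeasurableSingletonClass K] {p : X → K}
    (hp : Measurable p) : PM p := fun k => hp (measurableSet_singleton k)

lemma PM.preimage [Countable K] {p : X → K} (hp : PM p) (s : Set K) :
    MeasurableSet (p ⁻¹' s) := by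
  let _ : MeasurableSpace K := ⊤
  exact hp.measurable (MeasurableSpace.measurableSet_top)

lemma PM.map [Countable K] {p : X → K} (hp : PM p) (f : K → L) : PM (f ∘ p) := by
  intro l
  rw [Set.preimage_comp]
  exact hp.preimage _

lemma PM.pjoin {p : X → K} {q : X → L} (hp : PM p) (hq : PM q) : PM (pjoin p q) := by
  rintro ⟨k, l⟩
  have : (Bowen.pjoin p q) ⁻¹' {(k, l)} = p ⁻¹' {k} ∩ q ⁻¹' {l} := by
    ext x; simp [Bowen.pjoin]
  rw [this]; exact (hp k).inter (hq l)

lemma PM.pi {n : ℕ} {p : Fin n → X → K} (hp : ∀ i, PM (p i)) :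
    PM (fun x (i : Fin n) => p i x) := by
  intro k
  have : (fun x (i : Fin n) => p i x) ⁻¹' {k} = ⋂ i, p i ⁻¹' {k i} := by
    ext x; simp [funext_iff]
  rw [this]; exact MeasurableSet.iInter fun i => hp i _

lemma PM.comp {p : X → K} (hp : PM p) {t : X → X} (ht : Measurable t) : PM (fun x => p (t x)) :=
  fun k => ht (hp k)

lemma lint_part [Countable K] (ν : Measure X) {p : X → K} (hp : PM p) (G : K → ℝ≥0∞) :
    ∫⁻ x, G (p x) ∂ν = ∑' k, G k * ν (p ⁻¹' {k}) := by
  let _ : MeasurableSpace K := ⊤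
  have hm := hp.measurable
  rw [← lintegral_map (f := G) (g := p) measurable_from_top hm, lintegral_countable']
  congr 1; ext k
  rw [Measure.map_apply hm (measurableSet_singleton k)]

/-- information function value -/
def ilog (a : ℝ≥0∞) : ℝ≥0∞ := ENNReal.ofReal (- Real.log a.toReal)

lemma ofReal_negMulLog (a : ℝ≥0∞) (ha : a ≠ ⊤) :
    ENNReal.ofReal (Real.negMulLog a.toReal) = ilog a * a := by
  rw [ilog, Real.negMulLog]
  conv_rhs => rw [← ENNReal.ofReal_toReal ha]
  rw [ENNReal.toReal_ofReal ENNReal.toReal_nonneg, ← ENNReal.ofReal_mul' ENNReal.toReal_nonneg]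
  congr 1; ring

lemma measurable_ilog : Measurable ilog := by
  unfold ilog
  exact (Real.measurable_log.comp ENNReal.measurable_toReal).neg.ennreal_ofReal

lemma ilog_anti {a b : ℝ≥0∞} (ha : a ≠ 0) (hab : a ≤ b) (hb : b ≠ ⊤) : ilog b ≤ ilog a := by
  unfold ilog
  apply ENNReal.ofReal_le_ofReal
  apply neg_le_neg
  apply Real.log_le_log
  · exact ENNReal.toReal_pos ha (ne_top_of_le_ne_top hb hab)
  · exact ENNReal.toReal_mono hb hab

lemma Hpart_eq_tsum (ν : Measure X) [IsFiniteMeasure ν] (p : X → K) :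
    Hpart ν p = ∑' k, ilog (ν (p ⁻¹' {k})) * ν (p ⁻¹' {k}) := by
  unfold Hpart
  congr 1; ext k
  exact ofReal_negMulLog _ (measure_ne_top _ _)

lemma Hpart_eq_lint [Countable K] (ν : Measure X) [IsFiniteMeasure ν] {p : X → K} (hp : PM p) :
    Hpart ν p = ∫⁻ x, ilog (ν (p ⁻¹' {p x})) ∂ν := by
  rw [Hpart_eq_tsum, lint_part ν hp (fun k => ilog (ν (p ⁻¹' {k})))]

lemma ae_pos_atom [Countable K] (ν : Measure X) {p : X → K} :
    ∀ᵐ x ∂ν, ν (p ⁻¹' {p x}) ≠ 0 := by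
  have : {x | ¬ ν (p ⁻¹' {p x}) ≠ 0} ⊆ ⋃ k ∈ {k | ν (p ⁻¹' {k}) = 0}, p ⁻¹' {k} := by
    intro x hx
    simp only [ne_eq, not_not, Set.mem_ofPred_eq] at hx
    simp [hx]
  refine measure_mono_null this ?_
  rw [measure_biUnion_null_iff (Set.to_countable _)]
  intro k hk; exact hk

lemma Hpart_mono [Countable K] [Countable L] (ν : Measure X) [IsFiniteMeasure ν]
    {p : X → K} {q : X → L} (hp : PM p) (hq : PM q) (f : L → K) (h : p =ᵐ[ν] f ∘ q) :
    Hpart ν p ≤ Hpart ν q := by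
  rw [Hpart_eq_lint ν hp, Hpart_eq_lint ν hq]
  apply lintegral_mono_ae
  filter_upwards [ae_pos_atom ν (p := q), h] with x hx hpx
  apply ilog_anti hx _ (measure_ne_top _ _)
  apply measure_mono_ae
  filter_upwards [h] with y hy hyq
  change q y = q x at hyq
  change p y = p x
  rw [hy, hpx]; simp [hyq]

lemma key_pointwise {a b c d : ℝ≥0∞} (ha : a ≠ 0) (hd : d ≠ 0)
    (ha1 : a ≤ 1) (hd1 : d ≤ 1) (hb1 : b ≤ 1) (hc1 : c ≤ 1) (hab : a ≤ b) (hac : a ≤ c) :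
    1 + (ilog a + ilog d) ≤ (ilog b + ilog c) + (b * c / d) / a := by
  have hat := ne_top_of_le_ne_top ENNReal.one_ne_top ha1
  have hdt := ne_top_of_le_ne_top ENNReal.one_ne_top hd1
  have hbt := ne_top_of_le_ne_top ENNReal.one_ne_top hb1
  have hct := ne_top_of_le_ne_top ENNReal.one_ne_top hc1
  have hb : b ≠ 0 := fun h => ha (by simpa [h] using hab)
  have hc : c ≠ 0 := fun h => ha (by simpa [h] using hac)
  have pa := ENNReal.toReal_pos ha hat
  have pb := ENNReal.toReal_pos hb hbt
  have pc := ENNReal.toReal_pos hc hct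
  have pd := ENNReal.toReal_pos hd hdt
  have nl : ∀ x : ℝ≥0∞, x ≤ 1 → 0 ≤ - Real.log x.toReal := by
    intro x hx
    rw [neg_nonneg]
    exact Real.log_nonpos ENNReal.toReal_nonneg (by simpa using ENNReal.toReal_mono ENNReal.one_ne_top hx)
  have hratio : (b * c / d) / a = ENNReal.ofReal ((b.toReal * c.toReal / d.toReal) / a.toReal) := by
    rw [← ENNReal.toReal_mul, ← ENNReal.toReal_div, ← ENNReal.toReal_div, ENNReal.ofReal_toReal]
    exact ENNReal.div_ne_top (ENNReal.div_ne_top (ENNReal.mul_ne_top hbt hct) hd) ha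
  rw [hratio]
  unfold ilog
  rw [← ENNReal.ofReal_one, ← ENNReal.ofReal_add (nl a ha1) (nl d hd1),
    ← ENNReal.ofReal_add (nl b hb1) (nl c hc1), ← ENNReal.ofReal_add zero_le_one
      (add_nonneg (nl a ha1) (nl d hd1)),
    ← ENNReal.ofReal_add (add_nonneg (nl b hb1) (nl c hc1)) (by positivity)]
  apply ENNReal.ofReal_le_ofReal
  have h := Real.log_le_sub_one_of_pos (x := (b.toReal * c.toReal / d.toReal) / a.toReal)
    (by positivity)
  rw [Real.log_div (by positivity) (by positivity), Real.log_div (by positivity) (by positivity),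
    Real.log_mul (by positivity) (by positivity)] at h
  linarith

lemma tsum_fiber [Countable K] (ν : Measure X) {p : X → K} (hp : PM p) (B : Set X) : ∑' k, ν (p ⁻¹' {k} ∩ B) = ν B := by
  have h := lint_part (ν.restrict B) hp (fun _ => 1)
  simp only [lintegral_const, Measure.restrict_apply MeasurableSet.univ, Set.univ_inter, one_mul] at h
  rw [h]
  congr 1; ext k
  rw [Measure.restrict_apply (hp k)]

lemma ratio_le [Countable K] [Countable L] [Countable J] (ν : Measure X) [IsProbabilityMeasure ν]
    {p : X → K} {q : X → L} {s : X → J} (hp : PM p) (hq : PM q) (hs : PM s) :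
    ∫⁻ x, (ν (p ⁻¹' {p x} ∩ s ⁻¹' {s x}) * ν (q ⁻¹' {q x} ∩ s ⁻¹' {s x}) / ν (s ⁻¹' {s x}))
      / ν (p ⁻¹' {p x} ∩ (q ⁻¹' {q x} ∩ s ⁻¹' {s x})) ∂ν ≤ 1 := by
  have hpj : PM (pjoin p (pjoin q s)) := hp.pjoin (hq.pjoin hs)
  refine le_of_eq_of_le (lint_part ν hpj (fun k : K × L × J =>
    (ν (p ⁻¹' {k.1} ∩ s ⁻¹' {k.2.2}) * ν (q ⁻¹' {k.2.1} ∩ s ⁻¹' {k.2.2}) / ν (s ⁻¹' {k.2.2}))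
      / ν (p ⁻¹' {k.1} ∩ (q ⁻¹' {k.2.1} ∩ s ⁻¹' {k.2.2})))) ?_
  calc _ ≤ ∑' k : K × L × J, (ν (p ⁻¹' {k.1} ∩ s ⁻¹' {k.2.2}) *
            ν (q ⁻¹' {k.2.1} ∩ s ⁻¹' {k.2.2}) / ν (s ⁻¹' {k.2.2})) := by
          apply ENNReal.tsum_le_tsum
          rintro ⟨k, l, j⟩
          have : (pjoin p (pjoin q s)) ⁻¹' {(k, l, j)} = p ⁻¹' {k} ∩ (q ⁻¹' {l} ∩ s ⁻¹' {j}) := by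
            ext x; simp [pjoin]
          rw [this]
          exact ENNReal.mul_le_of_le_div le_rfl
    _ = ∑' j, ∑' l, ∑' k, (ν (p ⁻¹' {k} ∩ s ⁻¹' {j}) *
            ν (q ⁻¹' {l} ∩ s ⁻¹' {j}) / ν (s ⁻¹' {j})) := by
          rw [ENNReal.tsum_prod', ENNReal.tsum_comm, ENNReal.tsum_prod', ENNReal.tsum_comm]
    _ = ∑' j, ν (s ⁻¹' {j}) * ν (s ⁻¹' {j}) / ν (s ⁻¹' {j}) := by
          congr 1; ext j
          simp_rw [div_eq_mul_inv, ENNReal.tsum_mul_right, ENNReal.tsum_mul_left]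
          rw [tsum_fiber ν hp, tsum_fiber ν hq]
    _ ≤ ∑' j, ν (s ⁻¹' {j}) := by
          apply ENNReal.tsum_le_tsum
          intro j
          rw [mul_div_assoc]
          exact mul_le_of_le_one_right' ENNReal.div_self_le_one
    _ = 1 := by
          have := tsum_fiber ν hs Set.univ
          simpa using this

lemma mG [Countable K] {w : X → K} (hw : PM w) (G : K → ℝ≥0∞) :
    Measurable (fun x => G (w x)) := by
  let _ : MeasurableSpace K := ⊤
  exact (measurable_from_top (f := G)).comp hw.measurable

lemma Hpart_submod [Countable K] [Countable L] [Countable J] (ν : Measure X)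
    [IsProbabilityMeasure ν]
    {p : X → K} {q : X → L} {s : X → J} (hp : PM p) (hq : PM q) (hs : PM s) :
    Hpart ν (pjoin p (pjoin q s)) + Hpart ν s ≤ Hpart ν (pjoin p s) + Hpart ν (pjoin q s) := by
  have hps := hp.pjoin hs
  have hqs := hq.pjoin hs
  have hpqs := hp.pjoin hqs
  rw [Hpart_eq_lint ν hpqs, Hpart_eq_lint ν hs, Hpart_eq_lint ν hps, Hpart_eq_lint ν hqs]
  have e1 : ∀ x, (pjoin p s) ⁻¹' {pjoin p s x} = p ⁻¹' {p x} ∩ s ⁻¹' {s x} := by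
    intro x; ext y; simp [pjoin]
  have e2 : ∀ x, (pjoin q s) ⁻¹' {pjoin q s x} = q ⁻¹' {q x} ∩ s ⁻¹' {s x} := by
    intro x; ext y; simp [pjoin]
  have e3 : ∀ x, (pjoin p (pjoin q s)) ⁻¹' {pjoin p (pjoin q s) x} =
      p ⁻¹' {p x} ∩ (q ⁻¹' {q x} ∩ s ⁻¹' {s x}) := by
    intro x; ext y; simp [pjoin]
  have h := ratio_le ν hp hq hs
  have hae : ∀ᵐ x ∂ν, 1 + (ilog (ν (pjoin p (pjoin q s) ⁻¹' {pjoin p (pjoin q s) x})) +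
      ilog (ν (s ⁻¹' {s x}))) ≤
      (ilog (ν (pjoin p s ⁻¹' {pjoin p s x})) + ilog (ν (pjoin q s ⁻¹' {pjoin q s x}))) +
      (ν (p ⁻¹' {p x} ∩ s ⁻¹' {s x}) * ν (q ⁻¹' {q x} ∩ s ⁻¹' {s x}) / ν (s ⁻¹' {s x}))
      / ν (p ⁻¹' {p x} ∩ (q ⁻¹' {q x} ∩ s ⁻¹' {s x})) := by
    filter_upwards [ae_pos_atom ν (p := pjoin p (pjoin q s)), ae_pos_atom ν (p := s)] with x h1 h2
    rw [e3] at h1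
    rw [e1, e2, e3]
    exact key_pointwise h1 h2 prob_le_one prob_le_one prob_le_one prob_le_one
      (measure_mono (fun y hy => ⟨hy.1, hy.2.2⟩)) (measure_mono (fun y hy => hy.2))
  have h2 := lintegral_mono_ae hae
  rw [lintegral_add_left measurable_const,
    lintegral_add_left (mG hpqs (fun k => ilog (ν (pjoin p (pjoin q s) ⁻¹' {k})))),
    lintegral_add_left (show Measurable (fun x => ilog (ν (pjoin p s ⁻¹' {pjoin p s x})) +
        ilog (ν (pjoin q s ⁻¹' {pjoin q s x}))) from
      (mG hps (fun k => ilog (ν (pjoin p s ⁻¹' {k})))).add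
      (mG hqs (fun k => ilog (ν (pjoin q s ⁻¹' {k}))))),
    lintegral_add_left (mG hps (fun k => ilog (ν (pjoin p s ⁻¹' {k}))))] at h2
  simp only [lintegral_const, measure_univ, one_mul] at h2
  have h3 := h2.trans (add_le_add_right h _)
  rw [add_comm (1 : ℝ≥0∞)] at h3
  exact (ENNReal.add_le_add_iff_right ENNReal.one_ne_top).1 h3

lemma Hpart_const (ν : Measure X) [IsProbabilityMeasure ν] [Unique K] (p : X → K) :
    Hpart ν p = 0 := by
  unfold Hpart
  have : ∀ k, p ⁻¹' {k} = Set.univ := by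
    intro k; ext x; simp [Subsingleton.elim (p x) k]
  simp [this]

end Helpers

section Helpers2

variable {X : Type*} {m : MeasurableSpace X} [mX : MeasurableSpace X] {K L J : Type*}

open ProbabilityTheory in
lemma meas_aux {Y : Type*} [MeasurableSpace Y] [Countable K] {p : X → K} (hp : PM p)
    {F : Y → K → ℝ≥0∞} (hF : ∀ k, Measurable (fun y => F y k)) :
    Measurable (fun z : Y × X => F z.1 (p z.2)) := by
  let _ : MeasurableSpace K := ⊤
  have h : Measurable (fun z : Y × K => F z.1 z.2) := measurable_from_prod_countable_left hF
  exact h.comp (measurable_fst.prodMk (hp.measurable.comp measurable_snd))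

open ProbabilityTheory in
lemma lint_kernel [StandardBorelSpace X] (μ : Measure X) [IsProbabilityMeasure μ] (hm : m ≤ mX) {f : X × X → ℝ≥0∞} (hf : @Measurable _ _ (m.prod mX) _ f) :
    ∫⁻ x, f (x, x) ∂μ = ∫⁻ x, ∫⁻ y, f (x, y) ∂(condExpKernel μ m x) ∂μ := by
  have h1 := compProd_trim_condExpKernel (μ := μ) hm
  have h2 : @Measurable X (X × X) mX (m.prod mX) Function.diag :=
    @Measurable.prodMk X mX X X m mX id id (measurable_id'' hm) measurable_id
  have h3 := @lintegral_map X (X × X) mX (m.prod mX) μ f Function.diag hf h2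
  rw [← h1] at h3
  have h4 := @Measure.lintegral_compProd X X m mX (μ.trim hm) (condExpKernel μ m) _ _ f hf
  rw [h4] at h3
  have h5 : Measurable[m] (fun x => ∫⁻ y, f (x, y) ∂(condExpKernel μ m x)) :=
    @Measurable.lintegral_kernel_prod_right' X X m mX (condExpKernel μ m) _ f hf
  rw [lintegral_trim hm h5] at h3
  exact h3.symm

open ProbabilityTheory in
lemma meas_HK [StandardBorelSpace X] (μ : Measure X) [IsProbabilityMeasure μ] [Countable K] {p : X → K} (hp : PM p) :
    Measurable[m] (fun x => Hpart (condExpKernel μ m x) p) := by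
  unfold Hpart
  refine Measurable.ennreal_tsum fun k => ?_
  refine Measurable.ennreal_ofReal ?_
  exact Real.continuous_negMulLog.measurable.comp (measurable_condExpKernel (hp k)).ennreal_toReal

open ProbabilityTheory in
lemma HpartC_eq_s5 [StandardBorelSpace X] (μ : Measure X) [IsProbabilityMeasure μ] (hm : m ≤ mX) [Countable K] {p : X → K} (hp : PM p) :
    HpartC (mX := mX) μ p m = ∫⁻ x, Hpart (condExpKernel μ m x) p ∂μ := by
  have hae : ∀ᵐ x ∂μ, ∀ k, (condExpKernel μ m x).real (p ⁻¹' {k}) =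
      (μ[(p ⁻¹' {k}).indicator (fun _ => (1 : ℝ)) | m]) x :=
    ae_all_iff.2 fun k => condExpKernel_ae_eq_condExp hm (hp k)
  have h1 : HpartC (mX := mX) μ p m = ∫⁻ x, ilog (condExpKernel μ m x (p ⁻¹' {p x})) ∂μ := by
    unfold HpartC
    apply lintegral_congr_ae
    filter_upwards [hae] with x hx
    rw [atomOf, ← hx (p x)]
    rfl
  have hmeas : @Measurable _ _ (m.prod mX) _
      (fun z : X × X => ilog (condExpKernel μ m z.1 (p ⁻¹' {p z.2}))) :=
    @meas_aux X mX K X m _ p hp (fun x k => ilog (condExpKernel μ m x (p ⁻¹' {k})))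
      (fun k => measurable_ilog.comp (measurable_condExpKernel (hp k)))
  rw [h1, lint_kernel μ hm hmeas]
  congr 1; ext x
  rw [Hpart_eq_lint _ hp]

open ProbabilityTheory in
lemma ae_kernel [StandardBorelSpace X] (μ : Measure X) [IsProbabilityMeasure μ] (hm : m ≤ mX) {P : X → Prop} (h : ∀ᵐ x ∂μ, P x) :
    ∀ᵐ x ∂μ, ∀ᵐ y ∂(condExpKernel μ m x), P y := by
  apply ae_of_ae_trim hm
  refine Measure.ae_ae_of_ae_comp ?_
  rw [condExpKernel_comp_trim hm]
  exact h

lemma HpartC_mono [StandardBorelSpace X] (μ : Measure X) [IsProbabilityMeasure μ] (hm : m ≤ mX) [Countable K] [Countable L] {p : X → K} {q : X → L}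
    (hp : PM p) (hq : PM q) (f : L → K) (h : ∀ᵐ x ∂μ, p x = f (q x)) :
    HpartC (mX := mX) μ p m ≤ HpartC (mX := mX) μ q m := by
  rw [HpartC_eq_s5 μ hm hp, HpartC_eq_s5 μ hm hq]
  apply lintegral_mono_ae
  filter_upwards [ae_kernel μ hm h] with x hx
  exact Hpart_mono _ hp hq f hx

lemma HpartC_submod [StandardBorelSpace X] (μ : Measure X) [IsProbabilityMeasure μ] (hm : m ≤ mX) [Countable K] [Countable L] [Countable J]
    {p : X → K} {q : X → L} {s : X → J} (hp : PM p) (hq : PM q) (hs : PM s) :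
    HpartC (mX := mX) μ (pjoin p (pjoin q s)) m + HpartC (mX := mX) μ s m ≤
      HpartC (mX := mX) μ (pjoin p s) m + HpartC (mX := mX) μ (pjoin q s) m := by
  rw [HpartC_eq_s5 μ hm hs, HpartC_eq_s5 μ hm (hp.pjoin hs), HpartC_eq_s5 μ hm (hq.pjoin hs),
    HpartC_eq_s5 μ hm (hp.pjoin (hq.pjoin hs)),
    ← lintegral_add_right _ ((meas_HK μ hs).mono hm le_rfl),
    ← lintegral_add_right _ ((meas_HK μ (hq.pjoin hs)).mono hm le_rfl)]
  exact lintegral_mono fun x => Hpart_submod _ hp hq hs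

lemma HpartC_const [StandardBorelSpace X] (μ : Measure X) [IsProbabilityMeasure μ] (hm : m ≤ mX) [Unique K] {p : X → K} :
    HpartC (mX := mX) μ p m = 0 := by
  have hp : PM p := by
    intro k
    have : p ⁻¹' {k} = Set.univ := by
      ext x; simp [Subsingleton.elim (p x) k]
    rw [this]; exact MeasurableSet.univ
  rw [HpartC_eq_s5 μ hm hp]
  simp [Hpart_const]

open ProbabilityTheory in
lemma lint_condExpKernel [StandardBorelSpace X] (μ : Measure X) [IsProbabilityMeasure μ] (hm : m ≤ mX) {A B : Set X} (hA : MeasurableSet A)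
    (hB : MeasurableSet[m] B) :
    ∫⁻ x in B, condExpKernel μ m x A ∂μ = μ (A ∩ B) := by
  have hmeas : @Measurable _ _ (m.prod mX) _
      (fun z : X × X => B.indicator (1 : X → ℝ≥0∞) z.1 * A.indicator (1 : X → ℝ≥0∞) z.2) := by
    refine @Measurable.mul _ _ _ _ _ _ _ _ ?_ ?_
    · have mB : Measurable[m] (B.indicator (1 : X → ℝ≥0∞)) :=
        Measurable.indicator (m := m) (@measurable_const ℝ≥0∞ X _ m 1) hB
      exact mB.comp (@measurable_fst X X m mX)
    · exact Measurable.comp (measurable_one.indicator hA) (@measurable_snd X X m mX)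
  have h := lint_kernel μ hm hmeas
  have e1 : (fun x => B.indicator (1 : X → ℝ≥0∞) x * A.indicator (1 : X → ℝ≥0∞) x) =
      (A ∩ B).indicator 1 := by
    ext x
    by_cases h1 : x ∈ A <;> by_cases h2 : x ∈ B <;> simp [h1, h2]
  simp only at h
  rw [e1, lintegral_indicator_one (hA.inter (hm _ hB))] at h
  rw [h, ← lintegral_indicator (hm _ hB)]
  congr 1; ext x
  rw [lintegral_const_mul _ (measurable_one.indicator hA), lintegral_indicator_one hA]
  by_cases h2 : x ∈ B <;> simp [h2]

lemma ilog_tangent {t c : ℝ≥0∞} (ht : t ≤ 1) (hc : c ≤ 1) (hc0 : c ≠ 0) :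
    ilog t * t + t ≤ ilog c * t + c := by
  have htt := ne_top_of_le_ne_top ENNReal.one_ne_top ht
  have hct := ne_top_of_le_ne_top ENNReal.one_ne_top hc
  by_cases ht0 : t = 0
  · simp [ht0]
  have pt := ENNReal.toReal_pos ht0 htt
  have pc := ENNReal.toReal_pos hc0 hct
  have nl : ∀ x : ℝ≥0∞, x ≤ 1 → 0 ≤ - Real.log x.toReal := by
    intro x hx
    rw [neg_nonneg]
    exact Real.log_nonpos ENNReal.toReal_nonneg
      (by simpa using ENNReal.toReal_mono ENNReal.one_ne_top hx)
  unfold ilog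
  have et : t = ENNReal.ofReal t.toReal := (ENNReal.ofReal_toReal htt).symm
  have ec : c = ENNReal.ofReal c.toReal := (ENNReal.ofReal_toReal hct).symm
  have n1 := nl t ht
  have n2 := nl c hc
  generalize t.toReal = t' at *
  generalize c.toReal = c' at *
  subst et ec
  rw [← ENNReal.ofReal_mul n1, ← ENNReal.ofReal_mul n2, ← ENNReal.ofReal_add (by positivity)
    pt.le, ← ENNReal.ofReal_add (by positivity) pc.le]
  apply ENNReal.ofReal_le_ofReal
  have h := Real.log_le_sub_one_of_pos (x := c' / t') (by positivity)
  rw [Real.log_div pc.ne' pt.ne'] at h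
  have h' := mul_le_mul_of_nonneg_left h pt.le
  have : t' * (c' / t' - 1) = c' - t' := by field_simp
  nlinarith

open ProbabilityTheory in
lemma HpartC_le_Hpart [StandardBorelSpace X] (μ : Measure X) [IsProbabilityMeasure μ] (hm : m ≤ mX) [Countable K] {p : X → K} (hp : PM p) :
    HpartC (mX := mX) μ p m ≤ Hpart μ p := by
  rw [HpartC_eq_s5 μ hm hp, Hpart_eq_tsum]
  simp_rw [Hpart_eq_tsum]
  have mk : ∀ k, Measurable (fun x => condExpKernel μ m x (p ⁻¹' {k})) := fun k =>
    (measurable_condExpKernel (hp k)).mono hm le_rfl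
  have mk2 : ∀ k, AEMeasurable (fun x => ilog (condExpKernel μ m x (p ⁻¹' {k})) *
      condExpKernel μ m x (p ⁻¹' {k})) μ := fun k =>
    ((measurable_ilog.comp (mk k)).mul (mk k)).aemeasurable
  rw [lintegral_tsum mk2]
  apply ENNReal.tsum_le_tsum
  intro k
  have hcint : ∫⁻ x, condExpKernel μ m x (p ⁻¹' {k}) ∂μ = μ (p ⁻¹' {k}) := by
    have := lint_condExpKernel μ hm (hp k) (@MeasurableSet.univ X m)
    simpa using this
  set c := μ (p ⁻¹' {k}) with hc
  by_cases hc0 : c = 0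
  · rw [hc0] at hcint
    rw [lintegral_eq_zero_iff (mk k)] at hcint
    rw [hc0, mul_zero, nonpos_iff_eq_zero]
    apply (lintegral_eq_zero_iff ((measurable_ilog.comp (mk k)).mul (mk k))).2
    filter_upwards [hcint] with x hx
    simp only [Pi.zero_apply] at hx
    simp [hx]
  have h := lintegral_mono (μ := μ) (fun x =>
    ilog_tangent (t := condExpKernel μ m x (p ⁻¹' {k})) (c := c) prob_le_one prob_le_one hc0)
  rw [lintegral_add_right _ (mk k), lintegral_add_right _ measurable_const,
    lintegral_const_mul _ (mk k), hcint] at h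
  simp only [lintegral_const, measure_univ, mul_one] at h
  exact (ENNReal.add_le_add_iff_right (measure_ne_top _ _)).1 h

open ProbabilityTheory in
lemma HpartC_comp [StandardBorelSpace X] (μ : Measure X) [IsProbabilityMeasure μ] (hm : m ≤ mX) [Countable K] {p : X → K} (hp : PM p)
    {t u : X → X} (ht : MeasurePreserving t μ μ) (htm : Measurable[m, m] t)
    (hum : Measurable[m, m] u) (hut : ∀ x, u (t x) = x) :
    HpartC (mX := mX) μ (fun x => p (t x)) m = HpartC (mX := mX) μ p m := by
  have hpt := hp.comp ht.measurable
  have key : ∀ A, MeasurableSet A → ∀ᵐ x ∂μ,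
      condExpKernel μ m x (t ⁻¹' A) = condExpKernel μ m (t x) A := by
    intro A hA
    have m1 : Measurable[m] (fun x => condExpKernel μ m x (t ⁻¹' A)) :=
      measurable_condExpKernel (ht.measurable hA)
    have m2 : Measurable[m] (fun x => condExpKernel μ m (t x) A) :=
      (measurable_condExpKernel hA).comp htm
    refine ae_of_ae_trim hm (ae_eq_of_forall_setLIntegral_eq_of_sigmaFinite m1 m2 ?_)
    intro B hB _
    rw [restrict_trim hm _ hB, lintegral_trim hm m1, lintegral_trim hm m2,
      lint_condExpKernel μ hm (ht.measurable hA) hB]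
    have hB' : B = t ⁻¹' (u ⁻¹' B) := by
      ext x; simp [hut]
    have hB2 : MeasurableSet[m] (u ⁻¹' B) := hum hB
    have h6 := ht.setLIntegral_comp_preimage (hm _ hB2)
      ((measurable_condExpKernel (μ := μ) (m := m) hA).mono hm le_rfl)
    rw [← hB'] at h6
    rw [h6, lint_condExpKernel μ hm hA hB2]
    conv_lhs => rw [hB', ← Set.preimage_inter]
    exact ht.measure_preimage (hA.inter (hm _ hB2)).nullMeasurableSet
  have hae : ∀ᵐ x ∂μ, ∀ k, condExpKernel μ m x (t ⁻¹' (p ⁻¹' {k})) =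
      condExpKernel μ m (t x) (p ⁻¹' {k}) := ae_all_iff.2 fun k => key _ (hp k)
  rw [HpartC_eq_s5 μ hm hpt, HpartC_eq_s5 μ hm hp, ← ht.lintegral_comp ((meas_HK μ hp).mono hm le_rfl)]
  apply lintegral_congr_ae
  filter_upwards [hae] with x hx
  rw [Hpart_eq_tsum, Hpart_eq_tsum]
  congr 1; ext k
  rw [← hx k]; rfl

variable {r : ℕ}

/-- The standing hypotheses. -/
structure Sys (m : MeasurableSpace X) [mX : MeasurableSpace X] (μ : Measure X)
    (T : FG r → X → X) : Prop where
  hm : m ≤ mX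
  hT1 : T 1 = id
  hTmul : ∀ g h : FG r, T (g * h) = T g ∘ T h
  hTmp : ∀ g : FG r, MeasurePreserving (T g) μ μ
  hminv : ∀ (g : FG r) (A : Set X), MeasurableSet[m] A → MeasurableSet[m] (T g ⁻¹' A)

variable [StandardBorelSpace X] {μ : Measure X} [IsProbabilityMeasure μ] {T : FG r → X → X}

lemma Sys.pull_eq (S : Sys m μ T) [Countable K] {p : X → K} (hp : PM p) (g : FG r) :
    HpartC (mX := mX) μ (fun x => p (T g x)) m = HpartC (mX := mX) μ p m := by
  refine HpartC_comp μ S.hm hp (S.hTmp g) (u := T g⁻¹) (fun A hA => S.hminv g A hA)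
    (fun A hA => S.hminv g⁻¹ A hA) ?_
  intro x
  have := congrFun (S.hTmul g⁻¹ g) x
  rw [inv_mul_cancel, S.hT1] at this
  exact this.symm

lemma Sys.pm_pull (S : Sys m μ T) {p : X → K} (hp : PM p) (g : FG r) :
    PM (fun x => p (T g x)) := hp.comp (S.hTmp g).measurable

lemma Sys.mono (S : Sys m μ T) [Countable K] [Countable L] {p : X → K} {q : X → L}
    (hp : PM p) (hq : PM q) (h : ∀ x y, q x = q y → p x = p y) :
    HpartC (mX := mX) μ p m ≤ HpartC (mX := mX) μ q m := by
  obtain ⟨x0⟩ : Nonempty X := μ.nonempty_of_neZero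
  have hf : Function.FactorsThrough p q := fun x y hxy => h x y hxy
  refine HpartC_mono μ S.hm hp hq (Function.extend q p (fun _ => p x0)) ?_
  exact Filter.Eventually.of_forall fun x => (hf.extend_apply _ x).symm

lemma Sys.sub_le (S : Sys m μ T) [Countable K] [Countable L] [Countable J]
    {p : X → K} {q : X → L} {d : X → J} (hp : PM p) (hq : PM q) (hd : PM d)
    (h : ∀ x y, p x = p y → q x = q y) :
    HpartC (mX := mX) μ (pjoin p d) m + HpartC (mX := mX) μ q m ≤
      HpartC (mX := mX) μ p m + HpartC (mX := mX) μ (pjoin q d) m := by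
  have h1 := HpartC_submod μ S.hm hp hd hq
  refine le_trans (add_le_add_left ?_ _) (h1.trans (add_le_add ?_ ?_))
  · refine S.mono (hp.pjoin hd) (hp.pjoin (hd.pjoin hq)) ?_
    intro x y hxy
    simp only [pjoin, Prod.mk.injEq] at hxy ⊢
    tauto
  · refine S.mono (hp.pjoin hq) hp ?_
    intro x y hxy
    simp only [pjoin, Prod.mk.injEq]
    exact ⟨hxy, h x y hxy⟩
  · refine S.mono (hd.pjoin hq) (hq.pjoin hd) ?_
    intro x y hxy
    simp only [pjoin, Prod.mk.injEq] at hxy ⊢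
    tauto

lemma Sys.join_le (S : Sys m μ T) [Countable K] [Countable J]
    {p : X → K} {d : X → J} (hp : PM p) (hd : PM d) :
    HpartC (mX := mX) μ (pjoin p d) m ≤
      HpartC (mX := mX) μ p m + HpartC (mX := mX) μ d m := by
  have hu : PM (fun _ : X => ()) := fun k => by
    cases k; simp
  have h := S.sub_le hp hu hd (fun _ _ _ => rfl)
  rw [HpartC_const μ S.hm (p := fun _ : X => ()), add_zero] at h
  refine h.trans (add_le_add_right ?_ _)
  refine S.mono (hu.pjoin hd) hd ?_
  intro x y hxy
  simp only [pjoin, Prod.mk.injEq, true_and]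
  exact hxy

/-- finite orbit partition -/
def orb (T : FG r → X → X) (s : FG r) (n : ℕ) (p : X → K) : X → (Fin n → K) :=
  fun x (i : Fin n) => p (T (s ^ (i : ℕ)) x)

lemma Sys.pm_orb (S : Sys m μ T) {p : X → K} (hp : PM p) (s : FG r) (n : ℕ) :
    PM (orb T s n p) := PM.pi (fun i => S.pm_pull hp (s ^ (i : ℕ)))

lemma Sys.T_mul (S : Sys m μ T) (g h : FG r) (x : X) : T g (T h x) = T (g * h) x := by
  rw [S.hTmul]; rfl

lemma orb_inj {T : FG r → X → X} {s : FG r} {n : ℕ} {p : X → K} {x y : X} :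
    orb T s n p x = orb T s n p y ↔ ∀ i, i < n → p (T (s ^ i) x) = p (T (s ^ i) y) := by
  rw [funext_iff]
  exact ⟨fun h i hi => h ⟨i, hi⟩, fun h i => h i i.2⟩

lemma Sys.orb_add (S : Sys m μ T) [Countable K] {p : X → K} (hp : PM p) (s : FG r) (a b : ℕ) :
    HpartC (mX := mX) μ (orb T s (a + b) p) m ≤
      HpartC (mX := mX) μ (orb T s a p) m + HpartC (mX := mX) μ (orb T s b p) m := by
  have ha := S.pm_orb hp s a
  have hb := S.pm_orb hp s b
  rw [← S.pull_eq hb (s ^ a)]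
  refine le_trans ?_ (S.join_le ha (S.pm_pull hb (s ^ a)))
  refine S.mono (S.pm_orb hp s (a + b)) (ha.pjoin (S.pm_pull hb (s ^ a))) ?_
  intro x y hxy
  simp only [pjoin, Prod.mk.injEq] at hxy
  rw [orb_inj, orb_inj] at hxy
  rw [orb_inj]
  intro i hi
  by_cases h : i < a
  · exact hxy.1 i h
  · have := hxy.2 (i - a) (by omega)
    rw [S.T_mul, S.T_mul, ← pow_add, Nat.sub_add_cancel (by omega)] at this
    exact this

lemma Sys.orb_one (S : Sys m μ T) [Countable K] {p : X → K} (hp : PM p) (s : FG r) :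
    HpartC (mX := mX) μ (orb T s 1 p) m ≤ HpartC (mX := mX) μ p m := by
  refine S.mono (S.pm_orb hp s 1) hp ?_
  intro x y hxy
  rw [orb_inj]
  intro i hi
  have : i = 0 := by omega
  subst this
  simpa [S.hT1] using hxy

lemma Sys.orb_fin (S : Sys m μ T) [Countable K] {p : X → K} (hp : PM p) (s : FG r) (n : ℕ)
    (hf : HpartC (mX := mX) μ p m ≠ ⊤) :
    HpartC (mX := mX) μ (orb T s n p) m ≠ ⊤ := by
  induction n with
  | zero => rw [HpartC_const μ S.hm]; exact ENNReal.zero_ne_top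
  | succ n ih =>
    refine ne_top_of_le_ne_top ?_ (S.orb_add hp s n 1)
    exact ENNReal.add_ne_top.2 ⟨ih, ne_top_of_le_ne_top hf (S.orb_one hp s)⟩

lemma Sys.hrate_tendsto (S : Sys m μ T) [Countable K] {p : X → K} (hp : PM p) (s : FG r)
    (hf : HpartC (mX := mX) μ p m ≠ ⊤) :
    Tendsto (fun n : ℕ => (HpartC (mX := mX) μ (orb T s n p) m).toReal / n) atTop
      (nhds (hrateC (mX := mX) T μ m s p)) := by
  have hsub : Subadditive (fun n : ℕ => (HpartC (mX := mX) μ (orb T s n p) m).toReal) := by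
    intro a b
    rw [← ENNReal.toReal_add (S.orb_fin hp s a hf) (S.orb_fin hp s b hf)]
    exact ENNReal.toReal_mono (ENNReal.add_ne_top.2 ⟨S.orb_fin hp s a hf, S.orb_fin hp s b hf⟩)
      (S.orb_add hp s a b)
  have hb : BddBelow (Set.range fun n : ℕ =>
      (HpartC (mX := mX) μ (orb T s n p) m).toReal / n) := by
    refine ⟨0, ?_⟩
    rintro _ ⟨n, rfl⟩
    positivity
  have := hsub.tendsto_lim hb
  convert this using 2
  rw [Subadditive.lim, hrateC, iInf]
  congr 1
  ext z
  constructor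
  · rintro ⟨n, rfl⟩
    refine ⟨n + 1, by simp, ?_⟩
    simp
    rfl
  · rintro ⟨n, hn, rfl⟩
    refine ⟨n - 1, ?_⟩
    obtain ⟨k, rfl⟩ : ∃ k, n = k + 1 := ⟨n - 1, by simp at hn; omega⟩
    simp
    rfl

/-- the simple splitting -/
def spl (T : FG r → X → X) (s : FG r) (p : X → K) (b : K → L) : X → K × L :=
  pjoin p (fun x => b (p (T s x)))

lemma Sys.pm_spl (S : Sys m μ T) [Countable K] {p : X → K} (hp : PM p) (s : FG r) (b : K → L) :
    PM (spl T s p b) := hp.pjoin (S.pm_pull (hp.map b) s)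

lemma Sys.spl_fin (S : Sys m μ T) [Countable K] [Countable L] {p : X → K} (hp : PM p) (s : FG r)
    (b : K → L) (hf : HpartC (mX := mX) μ p m ≠ ⊤) :
    HpartC (mX := mX) μ (spl T s p b) m ≠ ⊤ := by
  refine ne_top_of_le_ne_top ?_ (S.join_le hp (S.pm_pull (hp.map b) s))
  refine ENNReal.add_ne_top.2 ⟨hf, ?_⟩
  rw [show HpartC (mX := mX) μ (fun x => b (p (T s x))) m =
    HpartC (mX := mX) μ (b ∘ p) m from S.pull_eq (hp.map b) s]
  refine ne_top_of_le_ne_top hf (S.mono (hp.map b) hp ?_)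
  intro x y hxy
  simp [hxy]

lemma toReal4 {A B C D : ℝ≥0∞} (h : A + B ≤ C + D) (hC : C ≠ ⊤) (hD : D ≠ ⊤) :
    A.toReal + B.toReal ≤ C.toReal + D.toReal := by
  have hCD : C + D ≠ ⊤ := ENNReal.add_ne_top.2 ⟨hC, hD⟩
  have hAB := ne_top_of_le_ne_top hCD h
  have hA : A ≠ ⊤ := ne_top_of_le_ne_top hAB le_self_add
  have hB : B ≠ ⊤ := ne_top_of_le_ne_top hAB le_add_self
  rw [← ENNReal.toReal_add hA hB, ← ENNReal.toReal_add hC hD]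
  exact ENNReal.toReal_mono hCD h

lemma Sys.pair_le (S : Sys m μ T) [Countable K] [Countable L] {p : X → K} (hp : PM p)
    (j : Fin r × Bool) (b : K → L) (hf : HpartC (mX := mX) μ p m ≠ ⊤) (i : Fin r) :
    (HpartC (mX := mX) μ (pjoin (spl T (gen j) p b)
        (pull T (FreeGroup.of i) (spl T (gen j) p b))) m).toReal ≤
      (HpartC (mX := mX) μ (pjoin p (pull T (FreeGroup.of i) p)) m).toReal +
      2 * ((HpartC (mX := mX) μ (spl T (gen j) p b) m).toReal -
        (HpartC (mX := mX) μ p m).toReal) -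
      (if i = j.1 then ((HpartC (mX := mX) μ (spl T (gen j) p b) m).toReal -
        (HpartC (mX := mX) μ p m).toReal) else 0) := by
  have hi : PM (pull T (FreeGroup.of i) p) := S.pm_pull hp _
  have hA := hp.pjoin hi
  have hd : PM (fun x => b (p (T (gen j) x))) := S.pm_pull (hp.map b) _
  have hTd : PM (fun x => b (p (T (gen j) (T (FreeGroup.of i) x)))) := S.pm_pull hd _
  have hγ := S.pm_spl hp (gen j) b
  have hγf := S.spl_fin hp (gen j) b hf
  have hTγ : PM (pull T (FreeGroup.of i) (spl T (gen j) p b)) := S.pm_pull hγ _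
  have hAf : HpartC (mX := mX) μ (pjoin p (pull T (FreeGroup.of i) p)) m ≠ ⊤ := by
    refine ne_top_of_le_ne_top ?_ (S.join_le hp hi)
    refine ENNReal.add_ne_top.2 ⟨hf, ?_⟩
    have := S.pull_eq hp (FreeGroup.of i)
    unfold pull
    rw [this]; exact hf
  have E1 := S.sub_le hA hp hd (by
    intro x y hxy
    simp only [pjoin, Prod.mk.injEq] at hxy
    exact hxy.1)
  have E2 := S.sub_le (hA.pjoin hd) hi hTd (by
    intro x y hxy
    simp only [pjoin, Prod.mk.injEq] at hxy
    exact hxy.1.2)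
  have e3 : HpartC (mX := mX) μ (pull T (FreeGroup.of i) p) m = HpartC (mX := mX) μ p m :=
    S.pull_eq hp _
  have e4 : HpartC (mX := mX) μ (pjoin (pull T (FreeGroup.of i) p)
      (fun x => b (p (T (gen j) (T (FreeGroup.of i) x))))) m =
      HpartC (mX := mX) μ (spl T (gen j) p b) m := S.pull_eq hγ (FreeGroup.of i)
  rw [e3, e4] at E2
  have hAdf := ne_top_of_le_ne_top (ENNReal.add_ne_top.2 ⟨hAf, hγf⟩) (le_self_add.trans E1)
  have hAddf := ne_top_of_le_ne_top (ENNReal.add_ne_top.2 ⟨hAdf, hγf⟩) (le_self_add.trans E2)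
  have R1 := toReal4 E1 hAf hγf
  have R2 := toReal4 E2 hAdf hγf
  have M1 := ENNReal.toReal_mono hAddf (S.mono (hγ.pjoin hTγ) ((hA.pjoin hd).pjoin hTd) (by
    intro x y hxy
    simp only [pjoin, spl, pull, Prod.mk.injEq] at hxy ⊢
    tauto))
  have e5 : (HpartC (mX := mX) μ (pjoin p (fun x => b (p (T (gen j) x)))) m).toReal =
    (HpartC (mX := mX) μ (spl T (gen j) p b) m).toReal := rfl
  rw [e5] at R1
  split_ifs with hij
  · obtain ⟨j1, jb⟩ := j
    simp only at hij
    subst hij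
    cases jb with
    | true =>
      have M2 := ENNReal.toReal_mono hAf (S.mono (hA.pjoin hd) hA (by
        intro x y hxy
        simp only [pjoin, pull, gen, cond_true, Prod.mk.injEq] at hxy ⊢
        exact ⟨hxy, congrArg b hxy.2⟩))
      linarith
    | false =>
      have M2 := ENNReal.toReal_mono hAdf (S.mono ((hA.pjoin hd).pjoin hTd) (hA.pjoin hd) (by
        intro x y hxy
        simp only [pjoin, pull, gen, cond_false, Prod.mk.injEq, S.T_mul, inv_mul_cancel, S.hT1,
          id] at hxy ⊢
        exact ⟨hxy, congrArg b hxy.1.1⟩))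
      linarith
  · linarith

lemma Sys.orb_le (S : Sys m μ T) [Countable K] [Countable L] {p : X → K} (hp : PM p)
    (t : FG r) (b : K → L) (s : FG r) (n : ℕ) :
    HpartC (mX := mX) μ (orb T s n (spl T t p b)) m + n * HpartC (mX := mX) μ p m ≤
      HpartC (mX := mX) μ (orb T s n p) m + n * HpartC (mX := mX) μ (spl T t p b) m := by
  have hd : PM (fun x => b (p (T t x))) := S.pm_pull (hp.map b) _
  have hγ := S.pm_spl hp t b
  have hn := S.pm_orb hp s n
  have key : ∀ k, k ≤ n →
      HpartC (mX := mX) μ (pjoin (orb T s n p) (orb T s k (fun x => b (p (T t x))))) m +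
        k * HpartC (mX := mX) μ p m ≤
      HpartC (mX := mX) μ (orb T s n p) m + k * HpartC (mX := mX) μ (spl T t p b) m := by
    intro k
    induction k with
    | zero =>
      intro _
      simp only [Nat.cast_zero, zero_mul, add_zero]
      refine S.mono (hn.pjoin (S.pm_orb hd s 0)) hn ?_
      intro x y hxy
      simp only [pjoin, Prod.mk.injEq]
      exact ⟨hxy, Subsingleton.elim _ _⟩
    | succ k ih =>
      intro hk
      have ih := ih (by omega)
      have hB := hn.pjoin (S.pm_orb hd s k)
      have E := S.sub_le hB (S.pm_pull hp (s ^ k)) (S.pm_pull hd (s ^ k)) (by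
        intro x y hxy
        simp only [pjoin, Prod.mk.injEq] at hxy
        rw [orb_inj] at hxy
        exact hxy.1 k (by omega))
      have e4 : HpartC (mX := mX) μ (pjoin (fun x => p (T (s ^ k) x))
        (fun x => b (p (T t (T (s ^ k) x))))) m =
        HpartC (mX := mX) μ (spl T t p b) m := S.pull_eq hγ (s ^ k)
      rw [S.pull_eq hp, e4] at E
      have M := S.mono (hn.pjoin (S.pm_orb hd s (k + 1))) (hB.pjoin (S.pm_pull hd (s ^ k))) (by
        intro x y hxy
        simp only [pjoin, Prod.mk.injEq] at hxy ⊢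
        refine ⟨hxy.1.1, ?_⟩
        have h2 := hxy.1.2
        rw [orb_inj] at h2 ⊢
        intro i hi
        rcases Nat.lt_succ_iff_lt_or_eq.1 hi with h | h
        · exact h2 i h
        · subst h; exact hxy.2)
      push_cast
      set a := HpartC (mX := mX) μ p m
      set c := HpartC (mX := mX) μ (spl T t p b) m
      calc _ ≤ _ + (k + 1) * a := add_le_add_left M _
        _ = (_ + a) + k * a := by ring
        _ ≤ _ := add_le_add_left E _
        _ = (HpartC (mX := mX) μ (pjoin (orb T s n p) (orb T s k (fun x => b (p (T t x))))) m
              + k * a) + c := by ring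
        _ ≤ _ := add_le_add_left ih _
        _ = _ := by ring
  refine le_trans (add_le_add_left ?_ _) (key n le_rfl)
  refine S.mono (S.pm_orb hγ s n) (hn.pjoin (S.pm_orb hd s n)) ?_
  intro x y hxy
  simp only [pjoin, Prod.mk.injEq] at hxy
  rw [orb_inj, orb_inj] at hxy
  rw [orb_inj]
  intro i hi
  simp only [spl, pjoin, Prod.mk.injEq]
  exact ⟨hxy.1 i hi, hxy.2 i hi⟩


lemma Sys.rate_le_gen (S : Sys m μ T) [Countable K] [Countable L] {p : X → K} (hp : PM p)
    (t : FG r) (b : K → L) (hf : HpartC (mX := mX) μ p m ≠ ⊤) (s : FG r) :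
    hrateC (mX := mX) T μ m s (spl T t p b) ≤ hrateC (mX := mX) T μ m s p +
      ((HpartC (mX := mX) μ (spl T t p b) m).toReal - (HpartC (mX := mX) μ p m).toReal) := by
  have hγ := S.pm_spl hp t b
  have hγf := S.spl_fin hp t b hf
  refine le_of_tendsto_of_tendsto (S.hrate_tendsto hγ s hγf)
    ((S.hrate_tendsto hp s hf).add_const _) ?_
  filter_upwards [eventually_ge_atTop 1] with n hn
  have h := toReal4 (S.orb_le hp t b s n) (S.orb_fin hp s n hf)
    (ENNReal.mul_ne_top (ENNReal.natCast_ne_top n) hγf)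
  simp only [ENNReal.toReal_mul, ENNReal.toReal_natCast] at h
  have hn0 : (0 : ℝ) < n := by exact_mod_cast hn
  rw [div_add' _ _ _ hn0.ne']
  apply div_le_div_of_nonneg_right _ hn0.le
  linarith

lemma Sys.rate_le_same (S : Sys m μ T) [Countable K] [Countable L] {p : X → K} (hp : PM p)
    (t : FG r) (b : K → L) (hf : HpartC (mX := mX) μ p m ≠ ⊤) (s : FG r)
    (hts : t = s ∨ t = s⁻¹) :
    hrateC (mX := mX) T μ m s (spl T t p b) ≤ hrateC (mX := mX) T μ m s p := by
  have hγ := S.pm_spl hp t b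
  have hγf := S.spl_fin hp t b hf
  have h1 : ∀ n, HpartC (mX := mX) μ (orb T s n (spl T t p b)) m ≤
      HpartC (mX := mX) μ (orb T s (n + 1) p) m := by
    intro n
    have ho := S.pm_orb hp s (n + 1)
    rcases hts with rfl | rfl
    · refine S.mono (S.pm_orb hγ t n) ho ?_
      intro x y hxy
      rw [orb_inj] at hxy ⊢
      intro i hi
      simp only [spl, pjoin, Prod.mk.injEq, S.T_mul, ← pow_succ']
      exact ⟨hxy i (by omega), congrArg b (hxy (i + 1) (by omega))⟩
    · rw [← S.pull_eq ho s⁻¹]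
      refine S.mono (S.pm_orb hγ s n) (S.pm_pull ho s⁻¹) ?_
      intro x y hxy
      rw [orb_inj] at hxy ⊢
      simp only [S.T_mul] at hxy
      intro i hi
      simp only [spl, pjoin, Prod.mk.injEq, S.T_mul]
      have a1 := hxy (i + 1) (by omega)
      have a2 := hxy i (by omega)
      rw [pow_succ, mul_inv_cancel_right] at a1
      have e : s⁻¹ * s ^ i = s ^ i * s⁻¹ :=
        ((Commute.refl s).inv_left.pow_right i).eq
      rw [e]
      exact ⟨a1, congrArg b a2⟩
  have hlim : Tendsto (fun n : ℕ => (HpartC (mX := mX) μ (orb T s n p) m).toReal / n +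
      (HpartC (mX := mX) μ (orb T s 1 p) m).toReal / n) atTop
      (nhds (hrateC (mX := mX) T μ m s p + 0)) :=
    (S.hrate_tendsto hp s hf).add (tendsto_const_div_atTop_nhds_zero_nat _)
  rw [add_zero] at hlim
  refine le_of_tendsto_of_tendsto' (S.hrate_tendsto hγ s hγf) hlim ?_
  intro n
  rw [← add_div]
  apply div_le_div_of_nonneg_right _ (Nat.cast_nonneg n)
  have hA := S.orb_fin hp s n hf
  have hB := S.orb_fin hp s 1 hf
  rw [← ENNReal.toReal_add hA hB]
  exact ENNReal.toReal_mono (ENNReal.add_ne_top.2 ⟨hA, hB⟩) ((h1 n).trans (S.orb_add hp s n 1))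

lemma Sys.rate_le (S : Sys m μ T) [Countable K] [Countable L] {p : X → K} (hp : PM p)
    (j : Fin r × Bool) (b : K → L) (hf : HpartC (mX := mX) μ p m ≠ ⊤) (i : Fin r) :
    hrateC (mX := mX) T μ m (FreeGroup.of i) (spl T (gen j) p b) ≤
      hrateC (mX := mX) T μ m (FreeGroup.of i) p +
      ((HpartC (mX := mX) μ (spl T (gen j) p b) m).toReal -
        (HpartC (mX := mX) μ p m).toReal) -
      (if i = j.1 then ((HpartC (mX := mX) μ (spl T (gen j) p b) m).toReal -
        (HpartC (mX := mX) μ p m).toReal) else 0) := by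
  split_ifs with hij
  · have := S.rate_le_same hp (gen j) b hf (FreeGroup.of i) (by
      obtain ⟨j1, jb⟩ := j
      simp only at hij
      subst hij
      cases jb <;> simp [gen])
    linarith
  · have := S.rate_le_gen hp (gen j) b hf (FreeGroup.of i)
    linarith

lemma Sys.spl_main (S : Sys m μ T) [Countable K] [Countable L] {p : X → K} (hp : PM p)
    (j : Fin r × Bool) (b : K → L) (hf : HpartC (mX := mX) μ p m ≠ ⊤) :
    FFc (mX := mX) T μ m (spl T (gen j) p b) ≤ FFc (mX := mX) T μ m p ∧
    FstarC (mX := mX) T μ m (spl T (gen j) p b) ≤ FstarC (mX := mX) T μ m p := by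
  constructor
  · have h := Finset.sum_le_sum (fun i (_ : i ∈ Finset.univ) => S.pair_le hp j b hf i)
    rw [Finset.sum_sub_distrib, Finset.sum_add_distrib] at h
    simp only [Finset.sum_const, Finset.card_univ, Fintype.card_fin, nsmul_eq_mul,
      Finset.sum_ite_eq', Finset.mem_univ, if_true] at h
    unfold FFc
    linarith
  · have h := Finset.sum_le_sum (fun i (_ : i ∈ Finset.univ) => S.rate_le hp j b hf i)
    rw [Finset.sum_sub_distrib, Finset.sum_add_distrib] at h
    simp only [Finset.sum_const, Finset.card_univ, Fintype.card_fin, nsmul_eq_mul,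
      Finset.sum_ite_eq', Finset.mem_univ, if_true] at h
    unfold FstarC
    linarith

lemma Sys.ae_pull (S : Sys m μ T) {P : X → Prop} (h : ∀ᵐ x ∂μ, P x) (g : FG r) :
    ∀ᵐ x ∂μ, P (T g x) :=
  (S.hTmp g).quasiMeasurePreserving.tendsto_ae.eventually h

lemma Sys.congr_F (S : Sys m μ T) [Countable K] [Countable L] {p : X → K} {q : X → L}
    (hp : PM p) (hq : PM q) (f : L → K) (g : K → L)
    (h1 : ∀ᵐ x ∂μ, p x = f (q x)) (h2 : ∀ᵐ x ∂μ, q x = g (p x)) :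
    FFc (mX := mX) T μ m p = FFc (mX := mX) T μ m q ∧
    FstarC (mX := mX) T μ m p = FstarC (mX := mX) T μ m q := by
  have e1 : HpartC (mX := mX) μ p m = HpartC (mX := mX) μ q m :=
    le_antisymm (HpartC_mono μ S.hm hp hq f h1) (HpartC_mono μ S.hm hq hp g h2)
  have e2 : ∀ s : FG r, HpartC (mX := mX) μ (pjoin p (pull T s p)) m =
      HpartC (mX := mX) μ (pjoin q (pull T s q)) m := by
    intro s
    have hP : PM (pjoin p (pull T s p)) := hp.pjoin (S.pm_pull hp s)
    have hQ : PM (pjoin q (pull T s q)) := hq.pjoin (S.pm_pull hq s)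
    apply le_antisymm
    · refine HpartC_mono μ S.hm hP hQ (Prod.map f f) ?_
      filter_upwards [h1, S.ae_pull h1 s] with x a1 a2
      simp [pjoin, pull, ← a1, ← a2]
    · refine HpartC_mono μ S.hm hQ hP (Prod.map g g) ?_
      filter_upwards [h2, S.ae_pull h2 s] with x a1 a2
      simp [pjoin, pull, ← a1, ← a2]
  have e3 : ∀ (s : FG r) (n : ℕ), HpartC (mX := mX) μ (orb T s n p) m =
      HpartC (mX := mX) μ (orb T s n q) m := by
    intro s n
    have hP := S.pm_orb hp s n
    have hQ := S.pm_orb hq s n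
    apply le_antisymm
    · refine HpartC_mono μ S.hm hP hQ (fun v i => f (v i)) ?_
      filter_upwards [ae_all_iff.2 fun i : Fin n => S.ae_pull h1 (s ^ (i : ℕ))] with x a1
      funext i
      exact a1 i
    · refine HpartC_mono μ S.hm hQ hP (fun v i => g (v i)) ?_
      filter_upwards [ae_all_iff.2 fun i : Fin n => S.ae_pull h2 (s ^ (i : ℕ))] with x a1
      funext i
      exact a1 i
  constructor
  · unfold FFc
    rw [e1]
    simp only [e2]
  · unfold FstarC
    rw [e1]
    congr 1
    refine Finset.sum_congr rfl fun i _ => ?_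
    unfold hrateC
    congr 1
    funext n
    exact congrArg (fun z : ℝ≥0∞ => z.toReal / ((n : ℝ) + 1)) (e3 (FreeGroup.of i) (n + 1))

lemma refines_fun {μ : Measure X} [Countable K] {p : X → K} {q : X → L} (h : Refines μ p q) :
    ∃ f : K → L, ∀ᵐ x ∂μ, q x = f (p x) := by
  choose f hf using h
  refine ⟨f, ?_⟩
  have : ∀ᵐ x ∂μ, ∀ k, p x = k → q x = f k := by
    refine ae_all_iff.2 fun k => ?_
    rw [ae_iff]
    refine measure_mono_null ?_ (hf k)
    intro x hx
    simpa using hx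
  filter_upwards [this] with x hx
  exact hx _ rfl

lemma Sys.chain (S : Sys m μ T) {α σ : X → ℕ} (hα : PM α) (hf : HpartC (mX := mX) μ α m ≠ ⊤)
    (h : Relation.ReflTransGen (SimpleSplit μ T) α σ) :
    ∃ σ' : X → ℕ, PM σ' ∧ (∀ᵐ x ∂μ, σ x = σ' x) ∧ HpartC (mX := mX) μ σ' m ≠ ⊤ ∧
      FFc (mX := mX) T μ m σ' ≤ FFc (mX := mX) T μ m α ∧
      FstarC (mX := mX) T μ m σ' ≤ FstarC (mX := mX) T μ m α := by
  induction h with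
  | refl => exact ⟨α, hα, Filter.Eventually.of_forall fun _ => rfl, hf, le_rfl, le_rfl⟩
  | tail _ hstep ih =>
    rename_i ρ τ _
    obtain ⟨ρ', hρ', hρe, hρf, hF, hFs⟩ := ih
    obtain ⟨s, ⟨j, rfl⟩, β, -, hβ, hτ1, hτ2⟩ := hstep
    obtain ⟨b, hb⟩ := refines_fun hβ
    obtain ⟨d, hd⟩ := refines_fun hτ1
    obtain ⟨c, hc⟩ := refines_fun hτ2
    have hγ := S.pm_spl hρ' (gen j) b
    have hγe : ∀ᵐ x ∂μ, pjoin ρ (pull T (gen j) β) x = spl T (gen j) ρ' b x := by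
      filter_upwards [hρe, S.ae_pull hρe (gen j), S.ae_pull hb (gen j)] with x a1 a2 a3
      simp only [pjoin, pull, spl, Prod.mk.injEq]
      exact ⟨a1, by rw [a3, a2]⟩
    have hτ' : PM (c ∘ spl T (gen j) ρ' b) := hγ.map c
    have hτe : ∀ᵐ x ∂μ, τ x = c (spl T (gen j) ρ' b x) := by
      filter_upwards [hγe, hc] with x a1 a2
      rw [a2, a1]
    have hde : ∀ᵐ x ∂μ, spl T (gen j) ρ' b x = d ((c ∘ spl T (gen j) ρ' b) x) := by
      filter_upwards [hγe, hd, hτe] with x a1 a2 a3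
      rw [Function.comp_apply, ← a3, ← a2, a1]
    have hcc := S.congr_F hτ' hγ c d (Filter.Eventually.of_forall fun _ => rfl) hde
    have hs := S.spl_main hρ' j b hρf
    refine ⟨c ∘ spl T (gen j) ρ' b, hτ', hτe, ?_, ?_, ?_⟩
    · exact ne_top_of_le_ne_top (S.spl_fin hρ' (gen j) b hρf)
        (HpartC_mono μ S.hm hτ' hγ c (Filter.Eventually.of_forall fun _ => rfl))
    · rw [hcc.1]; exact hs.1.trans hF
    · rw [hcc.2]; exact hs.2.trans hFs

lemma Sys.final (S : Sys m μ T) {α σ : X → ℕ} (hα : PM α) (hσ : PM σ) (hH : Hpart μ α < ⊤)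
    (hsplit : IsSplitting μ T α σ) :
    FFc (mX := mX) T μ m σ ≤ FFc (mX := mX) T μ m α ∧
      FstarC (mX := mX) T μ m σ ≤ FstarC (mX := mX) T μ m α := by
  obtain ⟨ρ, hρ, h1, h2⟩ := hsplit
  obtain ⟨ρ', hρ', hρe, -, hF, hFs⟩ := S.chain hα
    (ne_top_of_le_ne_top hH.ne (HpartC_le_Hpart μ S.hm hα)) hρ
  obtain ⟨f, hf⟩ := refines_fun h1
  obtain ⟨g, hg⟩ := refines_fun h2
  have hcc := S.congr_F hσ hρ' f g
    (by filter_upwards [hf, hρe] with x a1 a2; rw [a1, a2])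
    (by filter_upwards [hg, hρe] with x a1 a2; rw [← a2, a1])
  rw [hcc.1, hcc.2]
  exact ⟨hF, hFs⟩

lemma Sys.final2 (S : Sys m μ T) {α σ : X → ℕ} (hα : Measurable α) (hσ : Measurable σ)
    (hH : Hpart μ α < ⊤) (hsplit : IsSplitting μ T α σ) :
    FFc (mX := mX) T μ m σ ≤ FFc (mX := mX) T μ m α ∧
      FstarC (mX := mX) T μ m σ ≤ FstarC (mX := mX) T μ m α :=
  S.final (fun k => hα (measurableSet_singleton k)) (fun k => hσ (measurableSet_singleton k))
    hH hsplit

end Helpers2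

/-- `F` and `F_*` are monotone decreasing under splittings,
relative to a `T(G)`-invariant sub-σ-algebra `m`. -/
theorem stmt_5 {r : ℕ} (hr : 1 ≤ r) {X : Type*} [mX : MeasurableSpace X]
    [StandardBorelSpace X] (μ : Measure X) [IsProbabilityMeasure μ]
    (T : FG r → X → X) (hT1 : T 1 = id)
    (hTmul : ∀ g h : FG r, T (g * h) = T g ∘ T h)
    (hTmp : ∀ g : FG r, MeasurePreserving (T g) μ μ)
    (α σ : X → ℕ) (hαm : Measurable α) (hσm : Measurable σ)
    (hHα : Hpart μ α < ⊤)
    (hsplit : IsSplitting μ T α σ)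
    (m : MeasurableSpace X) (hm : m ≤ mX)
    (hminv : ∀ (g : FG r) (A : Set X), MeasurableSet[m] A → MeasurableSet[m] (T g ⁻¹' A)) :
    FFc (mX := mX) T μ m σ ≤ FFc (mX := mX) T μ m α ∧
      FstarC (mX := mX) T μ m σ ≤ FstarC (mX := mX) T μ m α := by
  have S : @Sys X r m mX μ T := @Sys.mk X r m mX μ T hm hT1 hTmul hTmp hminv
  exact @Sys.final2 X m mX r (by assumption) μ (by assumption) T S α σ hαm hσm hHα hsplit

end

end Bowen
end
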